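/- arXiv:1909.03811 — 7 statements merged into one kernel-verified Lean document; each statement's English description precedes it below -/
import Mathlib

section
/- Let V1 and V2 be finite-dimensional complex vector spaces, let a1, …, ar ∈ V1 be linearly independent and let b1, …, br ∈ V2 be linearly independent. If u ∈ V1 and w ∈ V2 are nonzero vectors such that the simple tensor u ⊗ w lies in the linear span of a1 ⊗ b1, …, ar ⊗ br, then u ⊗ w is a nonzero scalar multiple of ai ⊗ bi for some i ∈ {1, …, r}. -/
open scoped TensorProduct

/-- A linearly independent family over a field has a dual family of linear functionals. -/
theorem LinearIndependent.exists_dual_family {K V ι : Type*} [Field K] [AddCommGroup V]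
    [Module K V] [DecidableEq ι] {v : ι → V} (hv : LinearIndependent K v) :
    ∃ f : ι → Module.Dual K V, ∀ i j, f i (v j) = if j = i then 1 else 0 := by
  obtain ⟨g, hg⟩ := (Finsupp.linearCombination K v).exists_leftInverse_of_injective
    (LinearMap.ker_eq_bot.mpr hv)
  refine ⟨fun i => Finsupp.lapply i ∘ₗ g, fun i j => ?_⟩
  have hj : g (v j) = Finsupp.single j 1 := by
    simpa using LinearMap.congr_fun hg (Finsupp.single j 1)
  simp [hj, Finsupp.single_apply]

theorem stmt3 {V1 V2 : Type*}
    [AddCommGroup V1] [Module ℂ V1] [FiniteDimensional ℂ V1]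
    [AddCommGroup V2] [Module ℂ V2] [FiniteDimensional ℂ V2]
    (r : ℕ) (a : Fin r → V1) (b : Fin r → V2)
    (ha : LinearIndependent ℂ a) (hb : LinearIndependent ℂ b)
    (u : V1) (w : V2) (hu : u ≠ 0) (hw : w ≠ 0)
    (h : u ⊗ₜ[ℂ] w ∈ Submodule.span ℂ (Set.range fun i => a i ⊗ₜ[ℂ] b i)) :
    ∃ (i : Fin r) (c : ℂ), c ≠ 0 ∧ u ⊗ₜ[ℂ] w = c • (a i ⊗ₜ[ℂ] b i) := by
  obtain ⟨c, hc⟩ := (Submodule.mem_span_range_iff_exists_fun ℂ).mp h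
  obtain ⟨f, hf⟩ := ha.exists_dual_family
  obtain ⟨g, hg⟩ := hb.exists_dual_family
  have key (i j : Fin r) : f i u * g j w = if i = j then c j else 0 := by
    have := congrArg (LinearMap.mul' ℂ ℂ ∘ₗ TensorProduct.map (f i) (g j)) hc
    simpa [hf, hg, eq_comm] using this.symm
  have huw : u ⊗ₜ[ℂ] w ≠ 0 := by
    obtain ⟨φ, hφ⟩ := Module.Projective.exists_dual_ne_zero ℂ hu
    obtain ⟨ψ, hψ⟩ := Module.Projective.exists_dual_ne_zero ℂ hw
    intro h0
    have := congrArg (LinearMap.mul' ℂ ℂ ∘ₗ TensorProduct.map φ ψ) h0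
    simp [hφ, hψ] at this
  obtain ⟨i, hi⟩ : ∃ i, c i ≠ 0 := by
    by_contra! hall
    exact huw (by simp [← hc, hall])
  refine ⟨i, c i, hi, ?_⟩
  rw [← hc]
  refine Finset.sum_eq_single i (fun k _ hki => ?_) (by simp)
  have hii := key i i
  have hkk := key k k
  have hik := key i k
  rw [if_neg hki.symm] at hik
  simp only [if_true] at hii hkk
  have hck : c k = 0 := by
    rcases mul_eq_zero.mp hik with h0 | h0
    · exact absurd (by rw [← hii, h0, zero_mul]) hi
    · rw [← hkk, h0, mul_zero]
  rw [hck, zero_smul]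
end

section
/- Let V be a finite-dimensional complex vector space, let X ⊆ V be a nonempty subset closed under multiplication by nonzero scalars, and let L ⊆ V be a 2-dimensional linear subspace. Suppose x0, x1, …, xk ∈ X ∩ L are nonzero and pairwise non-proportional, and let p ∈ L be a nonzero vector that is not proportional to any element of X. Then for every r with 1 ≤ r ≤ k, the X^{×r}-rank of p^{⊗r} is at most r + 1; in particular, since R_X(p) = 2, for every r with 2 ≤ r ≤ k one has R_{X^{×r}}(p^{⊗r}) ≤ r + 1 < 2^r = R_X(p)^r. -/
open scoped TensorProduct

noncomputable section

/-- `p` lies in the linear span of some `r` elements of `X`. -/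
def HasRankLE {V : Type*} [AddCommGroup V] [Module ℂ V] (X : Set V) (p : V) (r : ℕ) : Prop :=
  ∃ v : Fin r → V, (∀ i, v i ∈ X) ∧ p ∈ Submodule.span ℂ (Set.range v)

/-- The `X`-rank of `p`. -/
def xrank {V : Type*} [AddCommGroup V] [Module ℂ V] (X : Set V) (p : V) : ℕ :=
  sInf {r | HasRankLE X p r}

/-- The `r`-fold Segre power `X^{×r} ⊆ V^{⊗r}` of a subset `X ⊆ V`. -/
def Xpow {V : Type*} [AddCommGroup V] [Module ℂ V] (X : Set V) (r : ℕ) :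
    Set (⨂[ℂ] _ : Fin r, V) :=
  {t | ∃ x : Fin r → V, (∀ i, x i ∈ X) ∧ t = PiTensorProduct.tprod ℂ x}

/-- The `r`-th tensor power `p^{⊗r} ∈ V^{⊗r}` of a vector `p ∈ V`. -/
def tpow {V : Type*} [AddCommGroup V] [Module ℂ V] (p : V) (r : ℕ) : ⨂[ℂ] _ : Fin r, V :=
  PiTensorProduct.tprod ℂ (fun _ => p)

/-- Two non-proportional vectors of a plane span it. -/
theorem exists_eq_smul_add_smul_of_finrank_eq_two {V : Type*} [AddCommGroup V] [Module ℂ V]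
    {L : Submodule ℂ V} (hL : Module.finrank ℂ L = 2) {a b : V} (ha : a ∈ L) (hb : b ∈ L)
    (hb0 : b ≠ 0) (hab : ∀ c : ℂ, a ≠ c • b) {y : V} (hy : y ∈ L) :
    ∃ s t : ℂ, y = s • a + t • b := by
  have : FiniteDimensional ℂ L := Module.finite_of_finrank_pos (by omega)
  have hli : LinearIndependent ℂ ![b, a] :=
    (LinearIndependent.pair_iff' hb0).2 fun c h => hab c h.symm
  have hle : Submodule.span ℂ (Set.range ![b, a]) ≤ L := by
    rw [Submodule.span_le]
    rintro _ ⟨i, rfl⟩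
    fin_cases i <;> simpa
  have heq := Submodule.eq_of_le_of_finrank_eq hle (by
    rw [finrank_span_eq_card hli, hL, Fintype.card_fin])
  rw [← heq, Matrix.range_cons_cons_empty, Submodule.mem_span_pair] at hy
  obtain ⟨t, s, rfl⟩ := hy
  exact ⟨s, t, add_comm _ _⟩

/-- Weights which extract the coefficient of degree `n` from the values of a polynomial of degree
at most `n` at `n + 1` distinct points. -/
theorem exists_sum_mul_pow_eq_ite {K : Type*} [Field K] {n : ℕ} {t : Fin (n + 1) → K}
    (ht : Function.Injective t) :
    ∃ w : Fin (n + 1) → K, ∀ j ≤ n, ∑ i, w i * t i ^ j = if j = n then 1 else 0 := by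
  have hdet : IsUnit (Matrix.vandermonde t).det :=
    (Matrix.det_vandermonde_ne_zero_iff.2 ht).isUnit
  let e : Fin (n + 1) → K := Pi.single (Fin.last n) 1
  refine ⟨Matrix.vecMul e (Matrix.vandermonde t)⁻¹, fun j hj => ?_⟩
  have h : Matrix.vecMul (Matrix.vecMul e (Matrix.vandermonde t)⁻¹) (Matrix.vandermonde t) = e := by
    rw [Matrix.vecMul_vecMul, Matrix.nonsing_inv_mul _ hdet, Matrix.vecMul_one]
  have := congrFun h ⟨j, by omega⟩
  simpa [Matrix.vecMul, dotProduct, Matrix.vandermonde_apply, e, Pi.single_apply, Fin.ext_iff]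
    using this

/-- The power `p^{⊗r}` lies in the span of the `r`-th powers of `r + 1` distinct points
`q + t i • p`. -/
theorem exists_tpow_eq_sum_smul_tpow {V : Type*} [AddCommGroup V] [Module ℂ V] {r : ℕ}
    {t : Fin (r + 1) → ℂ} (ht : Function.Injective t) (p q : V) :
    ∃ w : Fin (r + 1) → ℂ, tpow p r = ∑ i, w i • tpow (t i • p + q) r := by
  obtain ⟨w, hw⟩ := exists_sum_mul_pow_eq_ite ht
  refine ⟨w, ?_⟩
  have expand (c : ℂ) : tpow (c • p + q) r = ∑ s : Finset (Fin r),
      c ^ s.card • PiTensorProduct.tprod ℂ (s.piecewise (fun _ => p) (fun _ => q)) := by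
    have h := (PiTensorProduct.tprod ℂ (s := fun _ : Fin r => V)).map_add_univ
      (fun _ => c • p) (fun _ => q)
    refine h.trans (Finset.sum_congr rfl fun s _ => ?_)
    have h' := (PiTensorProduct.tprod ℂ (s := fun _ : Fin r => V)).map_piecewise_smul
      (fun _ => c) (s.piecewise (fun _ => p) (fun _ => q)) s
    rw [Finset.prod_const] at h'
    rw [← h']
    congr 1
    ext i
    by_cases hi : i ∈ s <;> simp [hi]
  simp_rw [expand, Finset.smul_sum, smul_smul]
  rw [Finset.sum_comm]
  simp_rw [← Finset.sum_smul]
  rw [Finset.sum_eq_single Finset.univ]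
  · rw [hw _ (by simp)]
    simp [tpow]
  · intro s _ hs
    have hc : s.card ≠ r := fun h => hs ((Finset.card_eq_iff_eq_univ s).1 (by simpa using h))
    rw [hw _ (by simpa using s.card_le_univ), if_neg hc, zero_smul]
  · simp

theorem stmt4 {V : Type*} [AddCommGroup V] [Module ℂ V] [FiniteDimensional ℂ V]
    (X : Set V) (hX : X.Nonempty)
    (hs : ∀ (c : ℂ), c ≠ 0 → ∀ x ∈ X, c • x ∈ X)
    (L : Submodule ℂ V) (hL : Module.finrank ℂ L = 2)
    (k : ℕ) (hk : 1 ≤ k) (x : Fin (k + 1) → V)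
    (hxX : ∀ i, x i ∈ X) (hxL : ∀ i, x i ∈ L) (hx0 : ∀ i, x i ≠ 0)
    (hxprop : ∀ i j, i ≠ j → ∀ c : ℂ, x i ≠ c • x j)
    (p : V) (hpL : p ∈ L) (hp0 : p ≠ 0)
    (hpX : ∀ (c : ℂ), ∀ y ∈ X, p ≠ c • y) :
    (∀ r, 1 ≤ r → r ≤ k → xrank (Xpow X r) (tpow p r) ≤ r + 1) ∧
    xrank X p = 2 ∧
    (∀ r, 2 ≤ r → r ≤ k →
      xrank (Xpow X r) (tpow p r) ≤ r + 1 ∧ r + 1 < (xrank X p) ^ r) := by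
  have hpx (i) (c : ℂ) : x i ≠ c • p := fun h => by
    have hc : c ≠ 0 := by rintro rfl; exact hx0 i (by simpa using h)
    exact hpX c⁻¹ (x i) (hxX i) (by rw [h, inv_smul_smul₀ hc])
  have hcoord (i) : ∃ b t : ℂ, x i = b • x 0 + t • p :=
    exists_eq_smul_add_smul_of_finrank_eq_two hL (hxL 0) hpL hp0 (hpx 0) (hxL i)
  choose b a hba using hcoord
  have hb (i) : b i ≠ 0 := fun h => hpx i (a i) (by simpa [h] using hba i)
  have hy (i) : (b i)⁻¹ • x i = ((b i)⁻¹ * a i) • p + x 0 := by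
    conv_lhs => rw [hba i]
    rw [smul_add, inv_smul_smul₀ (hb i), smul_smul, add_comm]
  have hinj : Function.Injective fun i => (b i)⁻¹ * a i := by
    intro i j hij
    by_contra hne
    refine hxprop i j hne (b i * (b j)⁻¹) ?_
    have h : (b i)⁻¹ • x i = (b j)⁻¹ • x j := by
      rw [hy, hy]
      exact congrArg (fun c => c • p + x 0) hij
    rw [mul_smul, ← h, smul_inv_smul₀ (hb i)]
  have hpow : ∀ r, 1 ≤ r → r ≤ k → xrank (Xpow X r) (tpow p r) ≤ r + 1 := by
    intro r _ hrk
    have hle : r + 1 ≤ k + 1 := by omega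
    obtain ⟨w, hw⟩ := exists_tpow_eq_sum_smul_tpow
      (hinj.comp (Fin.castLE_injective hle)) p (x 0)
    refine Nat.sInf_le ⟨fun i => tpow ((b (Fin.castLE hle i))⁻¹ • x (Fin.castLE hle i)) r,
      fun i => ⟨_, fun _ => hs _ (inv_ne_zero (hb _)) _ (hxX _), rfl⟩, ?_⟩
    rw [hw]
    refine Submodule.sum_mem _ fun i _ => Submodule.smul_mem _ _ (Submodule.subset_span ⟨i, ?_⟩)
    simp only [hy, Function.comp_apply]
  have hrank : xrank X p = 2 := by
    have h2 : HasRankLE X p 2 := by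
      have h01 : (0 : Fin (k + 1)) ≠ Fin.last k := by
        simp only [ne_eq, Fin.ext_iff, Fin.val_zero, Fin.val_last]
        omega
      obtain ⟨s, t, hst⟩ := exists_eq_smul_add_smul_of_finrank_eq_two hL (hxL 0)
        (hxL (Fin.last k)) (hx0 _) (hxprop _ _ h01) hpL
      refine ⟨![x 0, x (Fin.last k)], fun i => by fin_cases i <;> simp [hxX], ?_⟩
      rw [Matrix.range_cons_cons_empty, Submodule.mem_span_pair]
      exact ⟨s, t, hst.symm⟩
    refine le_antisymm (Nat.sInf_le h2) (le_csInf ⟨2, h2⟩ ?_)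
    rintro r ⟨v, hv, hpv⟩
    by_contra! hr
    interval_cases r
    · simp [Set.range_eq_empty] at hpv
      exact hp0 hpv
    · rw [Set.range_unique, Submodule.mem_span_singleton] at hpv
      obtain ⟨c, hc⟩ := hpv
      exact hpX c _ (hv _) hc.symm
  refine ⟨hpow, hrank, fun r hr2 hrk => ⟨hpow r (by omega) hrk, ?_⟩⟩
  rw [hrank]
  induction r, hr2 using Nat.le_induction with
  | base => norm_num
  | succ n hn ih =>
    have := ih (by omega)
    rw [pow_succ]
    omega
end
end

section
/- Let V be a finite-dimensional complex vector space, let X ⊆ V be a nonempty subset closed under multiplication by nonzero scalars, and let p ∈ V be a nonzero vector of finite X-rank m. If the X^{×2}-rank of p^{⊗2} is strictly less than m², then for every integer r ≥ 2 the X^{×r}-rank of p^{⊗r} is strictly less than m^r. -/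
open scoped TensorProduct

noncomputable section

/-- Tensor powers multiply: rank bounds in degrees `a` and `b` give one in degree `a + b`. -/
theorem HasRankLE.tpow_add {V : Type*} [AddCommGroup V] [Module ℂ V] {X : Set V} {p : V}
    {a b s t : ℕ} (ha : HasRankLE (Xpow X a) (tpow p a) s)
    (hb : HasRankLE (Xpow X b) (tpow p b) t) :
    HasRankLE (Xpow X (a + b)) (tpow p (a + b)) (s * t) := by
  obtain ⟨v, hv, hpv⟩ := ha
  obtain ⟨w, hw, hpw⟩ := hb
  let B : (⨂[ℂ]^a V) →ₗ[ℂ] (⨂[ℂ]^b V) →ₗ[ℂ] (⨂[ℂ]^(a + b) V) :=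
    (TensorProduct.mk ℂ _ _).compr₂ (TensorPower.mulEquiv (R := ℂ) (M := V)).toLinearMap
  have hB (x : Fin a → V) (y : Fin b → V) :
      B (PiTensorProduct.tprod ℂ x) (PiTensorProduct.tprod ℂ y) =
        PiTensorProduct.tprod ℂ (Fin.append x y) :=
    TensorPower.tprod_mul_tprod ℂ x y
  refine ⟨fun k => B (v (finProdFinEquiv.symm k).1) (w (finProdFinEquiv.symm k).2), fun k => ?_, ?_⟩
  · obtain ⟨x, hx, hvx⟩ := hv (finProdFinEquiv.symm k).1
    obtain ⟨y, hy, hwy⟩ := hw (finProdFinEquiv.symm k).2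
    refine ⟨Fin.append x y, fun i => ?_, ?_⟩
    · induction i using Fin.addCases with
      | left i => simpa using hx i
      | right i => simpa using hy i
    · simp only [hvx, hwy]
      exact hB x y
  · have hp : tpow p (a + b) = B (tpow p a) (tpow p b) := by
      refine Eq.trans ?_ (hB _ _).symm
      refine congrArg (PiTensorProduct.tprod ℂ) (funext fun i => ?_)
      induction i using Fin.addCases <;> simp
    rw [hp]
    have hmem := Submodule.apply_mem_map₂ B hpv hpw
    rw [Submodule.map₂_span_span] at hmem
    refine Submodule.span_mono ?_ hmem
    rintro _ ⟨_, ⟨i, rfl⟩, _, ⟨j, rfl⟩, rfl⟩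
    exact ⟨finProdFinEquiv (i, j), by simp⟩

theorem HasRankLE.tpow_one {V : Type*} [AddCommGroup V] [Module ℂ V] {X : Set V} {p : V}
    {m : ℕ} (h : HasRankLE X p m) : HasRankLE (Xpow X 1) (tpow p 1) m := by
  obtain ⟨v, hv, hp⟩ := h
  let L : V →ₗ[ℂ] ⨂[ℂ] _ : Fin 1, V :=
    (PiTensorProduct.subsingletonEquiv (R := ℂ) (s := fun _ : Fin 1 => V) 0).symm.toLinearMap
  have hL (x : V) : L x = PiTensorProduct.tprod ℂ (fun _ => x) :=
    PiTensorProduct.subsingletonEquiv_symm_apply' (0 : Fin 1) x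
  refine ⟨fun i => L (v i), fun i => ⟨fun _ => v i, fun _ => hv i, hL _⟩, ?_⟩
  have hmem := Submodule.mem_map_of_mem (f := L) hp
  rwa [Submodule.map_span, ← Set.range_comp, hL] at hmem

theorem HasRankLE.pos {V : Type*} [AddCommGroup V] [Module ℂ V] {X : Set V} {p : V}
    {m : ℕ} (h : HasRankLE X p m) (hp : p ≠ 0) : 0 < m := by
  obtain ⟨v, -, hpv⟩ := h
  rcases Nat.eq_zero_or_pos m with rfl | hm
  · simp [Set.range_eq_empty, hp] at hpv
  · exact hm

theorem stmt5 {V : Type*} [AddCommGroup V] [Module ℂ V] [FiniteDimensional ℂ V]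
    (X : Set V) (hX : X.Nonempty)
    (hs : ∀ (c : ℂ), c ≠ 0 → ∀ x ∈ X, c • x ∈ X)
    (p : V) (hp0 : p ≠ 0) (m : ℕ)
    (hm : HasRankLE X p m) (hrank : xrank X p = m)
    (h2 : xrank (Xpow X 2) (tpow p 2) < m ^ 2) :
    ∀ r, 2 ≤ r → xrank (Xpow X r) (tpow p r) < m ^ r := by
  have h1 := hm.tpow_one
  have hne : {s | HasRankLE (Xpow X 2) (tpow p 2) s}.Nonempty := ⟨m * m, h1.tpow_add h1⟩
  suffices key : ∀ r, 2 ≤ r → ∃ s < m ^ r, HasRankLE (Xpow X r) (tpow p r) s by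
    intro r hr
    obtain ⟨s, hs, h⟩ := key r hr
    exact (Nat.sInf_le h).trans_lt hs
  intro r hr
  induction r, hr using Nat.le_induction with
  | base => exact ⟨_, h2, Nat.sInf_mem hne⟩
  | succ r _ ih =>
    obtain ⟨s, hs, h⟩ := ih
    refine ⟨s * m, ?_, h.tpow_add h1⟩
    rw [pow_succ]
    exact Nat.mul_lt_mul_of_pos_right hs (hm.pos hp0)
end
end

section
/- Let V1 and V2 be finite-dimensional complex vector spaces, and let X1 ⊆ V1 and X2 ⊆ V2 be nonempty subsets closed under multiplication by nonzero scalars. If p1 ∈ V1 and p2 ∈ V2 are nonzero vectors with X1-rank of p1 equal to 2 and X2-rank of p2 equal to 2, then 3 ≤ R_{X1 × X2}(p1 ⊗ p2) ≤ 4. -/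
open scoped TensorProduct

noncomputable section

/-- The Segre product of two subsets. -/
def segre {V1 V2 : Type*} [AddCommGroup V1] [Module ℂ V1] [AddCommGroup V2] [Module ℂ V2]
    (X1 : Set V1) (X2 : Set V2) : Set (V1 ⊗[ℂ] V2) :=
  {t | ∃ x1 ∈ X1, ∃ x2 ∈ X2, t = x1 ⊗ₜ[ℂ] x2}

theorem HasRankLE.mono {V : Type*} [AddCommGroup V] [Module ℂ V] {X : Set V} (hX : X.Nonempty)
    {p : V} {r s : ℕ} (h : HasRankLE X p r) (hrs : r ≤ s) : HasRankLE X p s := by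
  obtain ⟨v, hv, hp⟩ := h
  obtain ⟨x, hx⟩ := hX
  refine ⟨fun i => if h : (i : ℕ) < r then v ⟨i, h⟩ else x, fun i => ?_,
    Submodule.span_mono ?_ hp⟩
  · dsimp only
    split_ifs
    exacts [hv _, hx]
  · rintro _ ⟨i, rfl⟩
    exact ⟨Fin.castLE hrs i, by simp⟩

theorem not_hasRankLE_of_lt_xrank {V : Type*} [AddCommGroup V] [Module ℂ V] {X : Set V}
    {p : V} {r : ℕ} (h : r < xrank X p) : ¬ HasRankLE X p r :=
  Nat.notMem_of_lt_sInf h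

theorem hasRankLE_xrank_of_pos {V : Type*} [AddCommGroup V] [Module ℂ V] {X : Set V}
    {p : V} (h : 0 < xrank X p) : HasRankLE X p (xrank X p) :=
  Nat.sInf_mem (Nat.nonempty_of_pos_sInf h)

theorem HasRankLE.tmul {V1 V2 : Type*} [AddCommGroup V1] [Module ℂ V1] [AddCommGroup V2]
    [Module ℂ V2] {X1 : Set V1} {X2 : Set V2} {p1 : V1} {p2 : V2} {m n : ℕ}
    (h1 : HasRankLE X1 p1 m) (h2 : HasRankLE X2 p2 n) :
    HasRankLE (segre X1 X2) (p1 ⊗ₜ[ℂ] p2) (m * n) := by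
  obtain ⟨v, hv, hp1⟩ := h1
  obtain ⟨w, hw, hp2⟩ := h2
  refine ⟨fun k => v k.divNat ⊗ₜ[ℂ] w k.modNat, fun k => ⟨_, hv _, _, hw _, rfl⟩, ?_⟩
  have h := Submodule.apply_mem_map₂ (TensorProduct.mk ℂ V1 V2) hp1 hp2
  rw [Submodule.map₂_span_span] at h
  refine Submodule.span_mono ?_ h
  rintro _ ⟨_, ⟨i, rfl⟩, _, ⟨j, rfl⟩, rfl⟩
  refine ⟨finProdFinEquiv (i, j), ?_⟩
  have hij := finProdFinEquiv.symm_apply_apply (i, j)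
  simp only [finProdFinEquiv_symm_apply, Prod.mk.injEq] at hij
  simp only [hij.1, hij.2, TensorProduct.mk_apply]

/-- A functional killing the first factor of one summand, but not `p1`, contracts a decomposition
of `p1 ⊗ p2` to a decomposition of `p2` with one summand less. -/
theorem HasRankLE.of_tmul_succ {V1 V2 : Type*} [AddCommGroup V1] [Module ℂ V1] [AddCommGroup V2]
    [Module ℂ V2] {X1 : Set V1} {X2 : Set V2} {p1 : V1} {p2 : V2} {r : ℕ}
    (h : HasRankLE (segre X1 X2) (p1 ⊗ₜ[ℂ] p2) (r + 1)) (h1 : ¬ HasRankLE X1 p1 1) :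
    HasRankLE X2 p2 r := by
  obtain ⟨v, hv, hp⟩ := h
  choose a ha b hb hab using hv
  have hp1 : p1 ∉ Submodule.span ℂ (Set.range fun _ : Fin 1 => a 0) :=
    fun hmem => h1 ⟨_, fun _ => ha 0, hmem⟩
  obtain ⟨f, hf, hker⟩ := Submodule.exists_le_ker_of_notMem hp1
  have hfa : f (a 0) = 0 := hker (Submodule.subset_span ⟨0, rfl⟩)
  let contract : V1 ⊗[ℂ] V2 →ₗ[ℂ] V2 := TensorProduct.lid ℂ V2 ∘ₗ f.rTensor V2
  have hcontract (x : V1) (y : V2) : contract (x ⊗ₜ y) = f x • y := by simp [contract]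
  refine ⟨fun i => b i.succ, fun i => hb _, ?_⟩
  have hle : Submodule.span ℂ (Set.range v) ≤
      (Submodule.span ℂ (Set.range fun i : Fin r => b i.succ)).comap contract := by
    rw [Submodule.span_le]
    rintro _ ⟨i, rfl⟩
    rw [SetLike.mem_coe, Submodule.mem_comap, hab, hcontract]
    refine Fin.cases ?_ (fun i => ?_) i
    · simp [hfa]
    · exact Submodule.smul_mem _ _ (Submodule.subset_span ⟨i, rfl⟩)
  have hmem := hle hp
  rw [Submodule.mem_comap, hcontract] at hmem
  exact (Submodule.smul_mem_iff _ hf).1 hmem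

theorem stmt6 {V1 V2 : Type*}
    [AddCommGroup V1] [Module ℂ V1] [FiniteDimensional ℂ V1]
    [AddCommGroup V2] [Module ℂ V2] [FiniteDimensional ℂ V2]
    (X1 : Set V1) (X2 : Set V2) (hX1 : X1.Nonempty) (hX2 : X2.Nonempty)
    (hs1 : ∀ (c : ℂ), c ≠ 0 → ∀ x ∈ X1, c • x ∈ X1)
    (hs2 : ∀ (c : ℂ), c ≠ 0 → ∀ x ∈ X2, c • x ∈ X2)
    (p1 : V1) (p2 : V2) (hp1 : p1 ≠ 0) (hp2 : p2 ≠ 0)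
    (hr1 : xrank X1 p1 = 2) (hr2 : xrank X2 p2 = 2) :
    3 ≤ xrank (segre X1 X2) (p1 ⊗ₜ[ℂ] p2) ∧ xrank (segre X1 X2) (p1 ⊗ₜ[ℂ] p2) ≤ 4 := by
  have h1 : HasRankLE X1 p1 2 := hr1 ▸ hasRankLE_xrank_of_pos (by omega)
  have h2 : HasRankLE X2 p2 2 := hr2 ▸ hasRankLE_xrank_of_pos (by omega)
  have h4 : HasRankLE (segre X1 X2) (p1 ⊗ₜ[ℂ] p2) 4 := h1.tmul h2
  refine ⟨le_csInf ⟨4, h4⟩ fun r hr => ?_, Nat.sInf_le h4⟩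
  by_contra! hlt
  obtain ⟨x1, hx1⟩ := hX1
  obtain ⟨x2, hx2⟩ := hX2
  have hne : (segre X1 X2).Nonempty := ⟨x1 ⊗ₜ x2, x1, hx1, x2, hx2, rfl⟩
  have hr' : HasRankLE (segre X1 X2) (p1 ⊗ₜ[ℂ] p2) (1 + 1) :=
    HasRankLE.mono hne hr (by omega)
  exact not_hasRankLE_of_lt_xrank (by omega)
    (hr'.of_tmul_succ (not_hasRankLE_of_lt_xrank (by omega)))
end
end

section
/- Let V1 and V2 be finite-dimensional complex vector spaces, and let X1 ⊆ V1 and X2 ⊆ V2 be nonempty subsets closed under multiplication by nonzero scalars. Let p1 ∈ V1 and p2 ∈ V2 be nonzero vectors with R_{X1}(p1) = 2 and R_{X2}(p2) = 2, and suppose R_{X1 × X2}(p1 ⊗ p2) = 3 with p1 ⊗ p2 in the linear span of a1 ⊗ b1, a2 ⊗ b2, a3 ⊗ b3 for some nonzero a1, a2, a3 ∈ X1 and b1, b2, b3 ∈ X2. Then: a1, a2, a3 are pairwise non-proportional and span a 2-dimensional subspace L1 ⊆ V1 containing a nonzero scalar multiple of p1; b1, b2, b3 are pairwise non-proportional and span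 a 2-dimensional subspace L2 ⊆ V2 containing a nonzero scalar multiple of p2; and there exist a linear isomorphism φ : L1 → L2 and nonzero scalars c1, c2, c3, c ∈ ℂ with φ(aj) = cj · bj for j = 1, 2, 3 and φ(p1) = c · p2. -/
open scoped TensorProduct

noncomputable section

section Rank

variable {V : Type*} [AddCommGroup V] [Module ℂ V] {X : Set V} {p : V}

theorem ne_smul_of_one_lt_xrank (h : 1 < xrank X p) {x : V} (hx : x ∈ X) (c : ℂ) :
    p ≠ c • x := by
  rintro rfl
  have : HasRankLE X (c • x) 1 :=
    ⟨fun _ => x, fun _ => hx, Submodule.smul_mem _ _ (Submodule.subset_span ⟨0, rfl⟩)⟩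
  exact h.not_ge (Nat.sInf_le this)

theorem ne_smul_add_smul_of_two_lt_xrank (h : 2 < xrank X p) {x y : V} (hx : x ∈ X) (hy : y ∈ X)
    (c d : ℂ) : p ≠ c • x + d • y := by
  rintro rfl
  have : HasRankLE X (c • x + d • y) 2 := by
    refine ⟨![x, y], fun i => by fin_cases i <;> simpa, ?_⟩
    exact add_mem (Submodule.smul_mem _ _ (Submodule.subset_span ⟨0, rfl⟩))
      (Submodule.smul_mem _ _ (Submodule.subset_span ⟨1, rfl⟩))
  exact h.not_ge (Nat.sInf_le this)

end Rank

section Contraction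

variable {K V W : Type*} [Field K] [AddCommGroup V] [Module K V] [AddCommGroup W] [Module K W]
  {p a₁ a₂ a₃ : V} {q b₁ b₂ b₃ : W}

theorem exists_dual_of_notMem_span_pair (h : q ∉ Submodule.span K {b₁, b₂}) :
    ∃ g : Module.Dual K W, g q ≠ 0 ∧ g b₁ = 0 ∧ g b₂ = 0 := by
  obtain ⟨g, hg, hle⟩ := Submodule.exists_le_ker_of_notMem h
  exact ⟨g, hg, hle (Submodule.subset_span (by simp)), hle (Submodule.subset_span (by simp))⟩

theorem exists_dual_of_ne_smul (h : ∀ c : K, q ≠ c • b₁) :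
    ∃ g : Module.Dual K W, g q ≠ 0 ∧ g b₁ = 0 := by
  have hq : q ∉ Submodule.span K {b₁, b₁} := by
    rw [Set.pair_eq_singleton, Submodule.mem_span_singleton]
    rintro ⟨c, rfl⟩
    exact h c rfl
  obtain ⟨g, hg, h₁, -⟩ := exists_dual_of_notMem_span_pair hq
  exact ⟨g, hg, h₁⟩

theorem contraction_right {s₁ s₂ s₃ : K}
    (h : p ⊗ₜ[K] q = s₁ • (a₁ ⊗ₜ[K] b₁) + s₂ • (a₂ ⊗ₜ[K] b₂) + s₃ • (a₃ ⊗ₜ[K] b₃))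
    (g : Module.Dual K W) :
    g q • p = g b₁ • s₁ • a₁ + g b₂ • s₂ • a₂ + g b₃ • s₃ • a₃ := by
  have := congrArg (fun t => TensorProduct.rid K V (g.lTensor V t)) h
  rw [smul_comm _ s₁, smul_comm _ s₂, smul_comm _ s₃]
  simpa using this

theorem contraction_left {s₁ s₂ s₃ : K}
    (h : p ⊗ₜ[K] q = s₁ • (a₁ ⊗ₜ[K] b₁) + s₂ • (a₂ ⊗ₜ[K] b₂) + s₃ • (a₃ ⊗ₜ[K] b₃))
    (f : Module.Dual K V) :
    f p • q = f a₁ • s₁ • b₁ + f a₂ • s₂ • b₂ + f a₃ • s₃ • b₃ := by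
  have := congrArg (fun t => TensorProduct.lid K W (f.rTensor W t)) h
  rw [smul_comm _ s₁, smul_comm _ s₂, smul_comm _ s₃]
  simpa using this

theorem ne_smul_of_smul_eq_smul {x y : K} (ha : a₃ ≠ 0) (hpa : ∀ c : K, p ≠ c • a₃) (hy : y ≠ 0) :
    x • p ≠ y • a₃ := by
  intro h
  rcases eq_or_ne x 0 with rfl | hx
  · exact smul_ne_zero hy ha (by simpa using h.symm)
  · exact hpa (x⁻¹ * y) (by rw [mul_smul, ← h, inv_smul_smul₀ hx])

theorem third_mem_span_pair_of_contraction
    (H : ∀ g : Module.Dual K W, g q • p = g b₁ • a₁ + g b₂ • a₂ + g b₃ • a₃)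
    (ha : a₃ ≠ 0) (hpa : ∀ c : K, p ≠ c • a₃) : b₃ ∈ Submodule.span K {b₁, b₂} := by
  by_contra hb
  obtain ⟨g, hg, h₁, h₂⟩ := exists_dual_of_notMem_span_pair hb
  exact ne_smul_of_smul_eq_smul ha hpa hg (by simpa [h₁, h₂] using H g)

theorem mem_span_pair_of_contraction
    (H : ∀ g : Module.Dual K W, g q • p = g b₁ • a₁ + g b₂ • a₂ + g b₃ • a₃)
    (hp : p ≠ 0) (ha : a₃ ≠ 0) (hpa : ∀ c : K, p ≠ c • a₃) : q ∈ Submodule.span K {b₁, b₂} := by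
  by_contra hq
  obtain ⟨g, hg, h₁, h₂⟩ := exists_dual_of_notMem_span_pair hq
  have h₃ := H g
  simp only [h₁, h₂, zero_smul, zero_add] at h₃
  rcases eq_or_ne (g b₃) 0 with h0 | h0
  · exact smul_ne_zero hg hp (by simpa [h0] using h₃)
  · exact ne_smul_of_smul_eq_smul ha hpa h0 h₃

theorem ne_smul_of_contraction
    (H : ∀ g : Module.Dual K W, g q • p = g b₁ • a₁ + g b₂ • a₂ + g b₃ • a₃)
    (hp : p ≠ 0) (ha : a₃ ≠ 0) (hpa : ∀ c : K, p ≠ c • a₃) (hqb : ∀ c : K, q ≠ c • b₂) (c : K) :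
    b₁ ≠ c • b₂ := by
  rintro rfl
  obtain ⟨d, e, hq⟩ := Submodule.mem_span_pair.1 (mem_span_pair_of_contraction H hp ha hpa)
  exact hqb (d * c + e) (by rw [← hq]; module)

theorem linearIndependent_pair_of_ne_smul (hb : b₂ ≠ 0) (h : ∀ c : K, b₁ ≠ c • b₂) :
    LinearIndependent K ![b₁, b₂] := by
  rw [LinearIndependent.pair_symm_iff, LinearIndependent.pair_iff' hb]
  exact fun c hc => h c hc.symm

/-- If `q` and `b₃` have coordinates `y` and `β` in `b₁, b₂`, and `p` and `a₃` have coordinates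
`x` and `α` in `a₁, a₂`, contracting against a functional that kills `b₂` compares the
coefficients of `a₂`. -/
theorem coord_mul_of_contraction {s₁ s₂ s₃ x₁ x₂ y₁ y₂ α₁ α₂ β₁ β₂ : K}
    (H : ∀ g : Module.Dual K W, g q • p = g b₁ • s₁ • a₁ + g b₂ • s₂ • a₂ + g b₃ • s₃ • a₃)
    (hb : ∀ c : K, b₁ ≠ c • b₂) (hA : LinearIndependent K ![a₁, a₂])
    (hp : x₁ • a₁ + x₂ • a₂ = p) (hq : y₁ • b₁ + y₂ • b₂ = q)
    (ha₃ : α₁ • a₁ + α₂ • a₂ = a₃) (hb₃ : β₁ • b₁ + β₂ • b₂ = b₃) :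
    y₁ * x₂ = β₁ * s₃ * α₂ := by
  obtain ⟨g, hg, h₂⟩ := exists_dual_of_ne_smul hb
  have h := H g
  rw [← hq, ← hb₃, ← hp, ← ha₃] at h
  simp only [map_add, map_smul, h₂, smul_eq_mul, mul_zero, add_zero, zero_smul] at h
  have h' := (LinearIndependent.pair_iff.1 hA
    (y₁ * g b₁ * x₁ - g b₁ * s₁ - β₁ * g b₁ * s₃ * α₁)
    (y₁ * g b₁ * x₂ - β₁ * g b₁ * s₃ * α₂) (by
      rw [← sub_eq_zero] at h
      rw [← h]
      module)).2
  apply mul_left_cancel₀ hg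
  linear_combination h'

theorem span_triple_eq_span_range_pair (h : b₃ ∈ Submodule.span K {b₁, b₂}) :
    Submodule.span K {b₁, b₂, b₃} = Submodule.span K (Set.range ![b₁, b₂]) := by
  rw [show ({b₁, b₂, b₃} : Set W) = insert b₃ {b₁, b₂} by ext; simp; tauto,
    Submodule.span_insert_eq_span h, Matrix.range_cons_cons_empty]

theorem exists_linearEquiv_of_pair {S : Submodule K V} {T : Submodule K W}
    (hS : S = Submodule.span K (Set.range ![a₁, a₂]))
    (hT : T = Submodule.span K (Set.range ![b₁, b₂]))
    (hA : LinearIndependent K ![a₁, a₂]) (hB : LinearIndependent K ![b₁, b₂])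
    {c₁ c₂ : K} (hc₁ : c₁ ≠ 0) (hc₂ : c₂ ≠ 0) :
    ∃ φ : S ≃ₗ[K] T, ∀ (x₁ x₂ : K) (v : V) (hv : v ∈ S), v = x₁ • a₁ + x₂ • a₂ →
      (φ ⟨v, hv⟩ : W) = (c₁ * x₁) • b₁ + (c₂ * x₂) • b₂ := by
  subst hS hT
  let A := Module.Basis.span hA
  let B := (Module.Basis.span hB).unitsSMul ![Units.mk0 c₁ hc₁, Units.mk0 c₂ hc₂]
  refine ⟨A.equiv B (Equiv.refl _), ?_⟩
  rintro x₁ x₂ _ hv rfl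
  have hv' : (⟨x₁ • a₁ + x₂ • a₂, hv⟩ : Submodule.span K (Set.range ![a₁, a₂])) =
      x₁ • A 0 + x₂ • A 1 := by
    ext
    simp [A, Module.Basis.span_apply]
  rw [hv', map_add, map_smul, map_smul, Module.Basis.equiv_apply, Module.Basis.equiv_apply]
  simp [B, Module.Basis.unitsSMul_apply, Module.Basis.span_apply, Units.smul_def, smul_smul,
    mul_comm]

end Contraction

theorem stmt8 {V1 V2 : Type*}
    [AddCommGroup V1] [Module ℂ V1] [FiniteDimensional ℂ V1]
    [AddCommGroup V2] [Module ℂ V2] [FiniteDimensional ℂ V2]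
    (X1 : Set V1) (X2 : Set V2) (hX1 : X1.Nonempty) (hX2 : X2.Nonempty)
    (hs1 : ∀ (c : ℂ), c ≠ 0 → ∀ x ∈ X1, c • x ∈ X1)
    (hs2 : ∀ (c : ℂ), c ≠ 0 → ∀ x ∈ X2, c • x ∈ X2)
    (p1 : V1) (p2 : V2) (hp1 : p1 ≠ 0) (hp2 : p2 ≠ 0)
    (hr1 : xrank X1 p1 = 2) (hr2 : xrank X2 p2 = 2)
    (a1 a2 a3 : V1) (b1 b2 b3 : V2)
    (ha1X : a1 ∈ X1) (ha2X : a2 ∈ X1) (ha3X : a3 ∈ X1)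
    (hb1X : b1 ∈ X2) (hb2X : b2 ∈ X2) (hb3X : b3 ∈ X2)
    (ha10 : a1 ≠ 0) (ha20 : a2 ≠ 0) (ha30 : a3 ≠ 0)
    (hb10 : b1 ≠ 0) (hb20 : b2 ≠ 0) (hb30 : b3 ≠ 0)
    (hmem : p1 ⊗ₜ[ℂ] p2 ∈
      Submodule.span ℂ ({a1 ⊗ₜ[ℂ] b1, a2 ⊗ₜ[ℂ] b2, a3 ⊗ₜ[ℂ] b3} : Set (V1 ⊗[ℂ] V2)))
    (hrank3 : xrank (segre X1 X2) (p1 ⊗ₜ[ℂ] p2) = 3) :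
    (∀ c : ℂ, a1 ≠ c • a2) ∧ (∀ c : ℂ, a1 ≠ c • a3) ∧ (∀ c : ℂ, a2 ≠ c • a3) ∧
    (∀ c : ℂ, b1 ≠ c • b2) ∧ (∀ c : ℂ, b1 ≠ c • b3) ∧ (∀ c : ℂ, b2 ≠ c • b3) ∧
    Module.finrank ℂ (Submodule.span ℂ ({a1, a2, a3} : Set V1)) = 2 ∧
    Module.finrank ℂ (Submodule.span ℂ ({b1, b2, b3} : Set V2)) = 2 ∧
    (∃ c : ℂ, c ≠ 0 ∧ c • p1 ∈ Submodule.span ℂ ({a1, a2, a3} : Set V1)) ∧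
    (∃ c : ℂ, c ≠ 0 ∧ c • p2 ∈ Submodule.span ℂ ({b1, b2, b3} : Set V2)) ∧
    ∃ (φ : (Submodule.span ℂ ({a1, a2, a3} : Set V1)) ≃ₗ[ℂ]
           (Submodule.span ℂ ({b1, b2, b3} : Set V2)))
      (c1 c2 c3 c : ℂ), c1 ≠ 0 ∧ c2 ≠ 0 ∧ c3 ≠ 0 ∧ c ≠ 0 ∧
      (φ ⟨a1, Submodule.subset_span (by simp)⟩ : V2) = c1 • b1 ∧
      (φ ⟨a2, Submodule.subset_span (by simp)⟩ : V2) = c2 • b2 ∧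
      (φ ⟨a3, Submodule.subset_span (by simp)⟩ : V2) = c3 • b3 ∧
      ∀ (hp : p1 ∈ Submodule.span ℂ ({a1, a2, a3} : Set V1)),
        (φ ⟨p1, hp⟩ : V2) = c • p2 := by
  have hpa : ∀ {a : V1}, a ∈ X1 → ∀ c : ℂ, p1 ≠ c • a :=
    fun ha => ne_smul_of_one_lt_xrank (by omega) ha
  have hpb : ∀ {b : V2}, b ∈ X2 → ∀ c : ℂ, p2 ≠ c • b :=
    fun hb => ne_smul_of_one_lt_xrank (by omega) hb
  obtain ⟨s1, s2, s3, hs⟩ := Submodule.mem_span_triple.1 hmem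
  have hne := fun {x y : V1 ⊗[ℂ] V2} (hx : x ∈ segre X1 X2) (hy : y ∈ segre X1 X2) =>
    ne_smul_add_smul_of_two_lt_xrank (X := segre X1 X2) (p := p1 ⊗ₜ[ℂ] p2) (by omega) hx hy
  have ht1 : a1 ⊗ₜ[ℂ] b1 ∈ segre X1 X2 := ⟨a1, ha1X, b1, hb1X, rfl⟩
  have ht2 : a2 ⊗ₜ[ℂ] b2 ∈ segre X1 X2 := ⟨a2, ha2X, b2, hb2X, rfl⟩
  have ht3 : a3 ⊗ₜ[ℂ] b3 ∈ segre X1 X2 := ⟨a3, ha3X, b3, hb3X, rfl⟩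
  have hne1 : s1 ≠ 0 := by
    rintro rfl
    exact hne ht2 ht3 s2 s3 (by rw [← hs]; module)
  have hne2 : s2 ≠ 0 := by
    rintro rfl
    exact hne ht1 ht3 s1 s3 (by rw [← hs]; module)
  have hne3 : s3 ≠ 0 := by
    rintro rfl
    exact hne ht1 ht2 s1 s2 (by rw [← hs]; module)
  have hR := contraction_right hs.symm
  have hL := contraction_left hs.symm
  have hpsa : ∀ {a : V1}, a ∈ X1 → ∀ s c : ℂ, p1 ≠ c • s • a :=
    fun ha s c => by rw [smul_smul]; exact hpa ha _
  have hpsb : ∀ {b : V2}, b ∈ X2 → ∀ s c : ℂ, p2 ≠ c • s • b :=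
    fun hb s c => by rw [smul_smul]; exact hpb hb _
  have hsa3 := smul_ne_zero hne3 ha30
  have hsb3 := smul_ne_zero hne3 hb30
  have hsa2 := smul_ne_zero hne2 ha20
  have hsb2 := smul_ne_zero hne2 hb20
  have hsa1 := smul_ne_zero hne1 ha10
  have hsb1 := smul_ne_zero hne1 hb10
  have a12 := ne_smul_of_contraction hL hp2 hsb3 (hpsb hb3X s3) (hpa ha2X)
  have a21 := ne_smul_of_contraction (fun f => by rw [hL f]; abel) hp2 hsb3 (hpsb hb3X s3)
    (hpa ha1X) (b₁ := a2) (a₁ := s2 • b2) (a₂ := s1 • b1)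
  have a13 := ne_smul_of_contraction (fun f => by rw [hL f]; abel) hp2 hsb2 (hpsb hb2X s2)
    (hpa ha3X) (b₁ := a1) (a₁ := s1 • b1) (a₂ := s3 • b3)
  have a23 := ne_smul_of_contraction (fun f => by rw [hL f]; abel) hp2 hsb1 (hpsb hb1X s1)
    (hpa ha3X) (b₁ := a2) (a₁ := s2 • b2) (a₂ := s3 • b3)
  have a31 := ne_smul_of_contraction (fun f => by rw [hL f]; abel) hp2 hsb2 (hpsb hb2X s2)
    (hpa ha1X) (b₁ := a3) (a₁ := s3 • b3) (a₂ := s1 • b1)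
  have a32 := ne_smul_of_contraction (fun f => by rw [hL f]; abel) hp2 hsb1 (hpsb hb1X s1)
    (hpa ha2X) (b₁ := a3) (a₁ := s3 • b3) (a₂ := s2 • b2)
  have b12 := ne_smul_of_contraction hR hp1 hsa3 (hpsa ha3X s3) (hpb hb2X)
  have b21 := ne_smul_of_contraction (fun f => by rw [hR f]; abel) hp1 hsa3 (hpsa ha3X s3)
    (hpb hb1X) (b₁ := b2) (a₁ := s2 • a2) (a₂ := s1 • a1)
  have b13 := ne_smul_of_contraction (fun f => by rw [hR f]; abel) hp1 hsa2 (hpsa ha2X s2)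
    (hpb hb3X) (b₁ := b1) (a₁ := s1 • a1) (a₂ := s3 • a3)
  have b23 := ne_smul_of_contraction (fun f => by rw [hR f]; abel) hp1 hsa1 (hpsa ha1X s1)
    (hpb hb3X) (b₁ := b2) (a₁ := s2 • a2) (a₂ := s3 • a3)
  have b31 := ne_smul_of_contraction (fun f => by rw [hR f]; abel) hp1 hsa2 (hpsa ha2X s2)
    (hpb hb1X) (b₁ := b3) (a₁ := s3 • a3) (a₂ := s1 • a1)
  have b32 := ne_smul_of_contraction (fun f => by rw [hR f]; abel) hp1 hsa1 (hpsa ha1X s1)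
    (hpb hb2X) (b₁ := b3) (a₁ := s3 • a3) (a₂ := s2 • a2)
  have hA := linearIndependent_pair_of_ne_smul ha20 a12
  have hB := linearIndependent_pair_of_ne_smul hb20 b12
  have hA' := linearIndependent_pair_of_ne_smul ha10 a21
  have ha3 := third_mem_span_pair_of_contraction hL hsb3 (hpsb hb3X s3)
  have hb3 := third_mem_span_pair_of_contraction hR hsa3 (hpsa ha3X s3)
  have hpA := mem_span_pair_of_contraction hL hp2 hsb3 (hpsb hb3X s3)
  have hpB := mem_span_pair_of_contraction hR hp1 hsa3 (hpsa ha3X s3)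
  have hSA := span_triple_eq_span_range_pair ha3
  have hSB := span_triple_eq_span_range_pair hb3
  obtain ⟨α1, α2, hα⟩ := Submodule.mem_span_pair.1 ha3
  obtain ⟨β1, β2, hβ⟩ := Submodule.mem_span_pair.1 hb3
  obtain ⟨x1, x2, hx⟩ := Submodule.mem_span_pair.1 hpA
  obtain ⟨y1, y2, hy⟩ := Submodule.mem_span_pair.1 hpB
  have hα1 : α1 ≠ 0 := by
    rintro rfl
    exact a32 α2 (by rw [← hα]; module)
  have hα2 : α2 ≠ 0 := by
    rintro rfl
    exact a31 α1 (by rw [← hα]; module)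
  have hβ1 : β1 ≠ 0 := by
    rintro rfl
    exact b32 β2 (by rw [← hβ]; module)
  have hβ2 : β2 ≠ 0 := by
    rintro rfl
    exact b31 β1 (by rw [← hβ]; module)
  have e1 : y1 * x2 = β1 * s3 * α2 := coord_mul_of_contraction hR b12 hA hx hy hα hβ
  have e2 : y2 * x1 = β2 * s3 * α1 :=
    coord_mul_of_contraction (fun g => by rw [hR g]; abel) b21 hA'
      (by rw [← hx, add_comm]) (by rw [← hy, add_comm]) (by rw [← hα, add_comm])
      (by rw [← hβ, add_comm]) (b₁ := b2) (s₁ := s2) (s₂ := s1)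
  have hy1 : y1 ≠ 0 := left_ne_zero_of_mul (e1 ▸ by simp [*] : y1 * x2 ≠ 0)
  have hx1 : x1 ≠ 0 := right_ne_zero_of_mul (e2 ▸ by simp [*] : y2 * x1 ≠ 0)
  obtain ⟨φ, hφ⟩ := exists_linearEquiv_of_pair hSA hSB hA hB
    (div_ne_zero hβ1 hα1) (div_ne_zero hβ2 hα2)
  refine ⟨a12, a13, a23, b12, b13, b23, ?_, ?_, ⟨1, one_ne_zero, ?_⟩, ⟨1, one_ne_zero, ?_⟩,
    φ, β1 / α1, β2 / α2, 1, β1 / α1 * x1 / y1, div_ne_zero hβ1 hα1, div_ne_zero hβ2 hα2,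
    one_ne_zero, by simp [*], ?_, ?_, ?_, fun hp => ?_⟩
  · rw [hSA, finrank_span_eq_card hA, Fintype.card_fin]
  · rw [hSB, finrank_span_eq_card hB, Fintype.card_fin]
  · rw [one_smul, hSA, Matrix.range_cons_cons_empty]
    exact hpA
  · rw [one_smul, hSB, Matrix.range_cons_cons_empty]
    exact hpB
  · rw [hφ 1 0 _ _ (by module)]
    module
  · rw [hφ 0 1 _ _ (by module)]
    module
  · rw [hφ α1 α2 _ _ hα.symm, div_mul_cancel₀ _ hα1, div_mul_cancel₀ _ hα2, one_smul, hβ]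
  · have hcoord : β2 / α2 * x2 = β1 / α1 * x1 / y1 * y2 := by
      field_simp
      linear_combination α1 * β2 * e1 - α2 * β1 * e2
    rw [hφ x1 x2 _ _ hx.symm, hcoord, ← hy, smul_add, smul_smul, smul_smul,
      div_mul_cancel₀ _ hy1]
end
end

section
/- Let V be a finite-dimensional complex vector space and let X ⊆ V be a nonempty subset closed under multiplication by nonzero scalars. Let W ⊆ V be an (r+1)-dimensional linear subspace, let z0, …, zr ∈ X be a basis of W, and let w ∈ X ∩ W with w = c0·z0 + ⋯ + cr·zr where every coefficient ci is nonzero. Then for every nonzero p ∈ W, the X^{×(r+1)}-rank of p^{⊗(r+1)} is at most (r+1)^{r+1} − (r+1)! + 1. -/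
open scoped TensorProduct

noncomputable section

/-- The number of non-bijective self-maps of `Fin n`. -/
theorem card_not_bijective (n : ℕ) :
    Nat.card {f : Fin n → Fin n // ¬ Function.Bijective f} = n ^ n - Nat.factorial n := by
  classical
  have h : Fintype.card {f : Fin n → Fin n // Function.Bijective f} = Nat.factorial n := by
    rw [Fintype.card_congr (Equiv.ofBijective
      (fun f : {f : Fin n → Fin n // Function.Bijective f} => Equiv.ofBijective f.1 f.2)
      ⟨fun f g hfg => Subtype.ext (congrArg (fun e : Equiv.Perm (Fin n) => (e : Fin n → Fin n)) hfg),
        fun e => ⟨⟨e, e.bijective⟩, Equiv.ext fun _ => rfl⟩⟩), Fintype.card_perm, Fintype.card_fin]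
  rw [Nat.card_eq_fintype_card, Fintype.card_subtype_compl, h]
  simp

/-- The tensor power of a linear combination, expanded in the pure tensors of its terms. -/
theorem tpow_sum_smul {V : Type*} [AddCommGroup V] [Module ℂ V] {n m : ℕ}
    (a : Fin m → ℂ) (z : Fin m → V) :
    tpow (∑ i, a i • z i) n =
      ∑ f : Fin n → Fin m, (∏ j, a (f j)) • PiTensorProduct.tprod ℂ (fun j => z (f j)) := by
  classical
  unfold tpow
  rw [MultilinearMap.map_sum (PiTensorProduct.tprod ℂ) (fun (_ : Fin n) i => a i • z i)]
  exact Finset.sum_congr rfl fun f _ => MultilinearMap.map_smul_univ _ _ _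

/-- A family indexed by a finite type may be used to bound the rank by the size of that type. -/
theorem HasRankLE.of_fintype {V ι : Type*} [AddCommGroup V] [Module ℂ V] [Finite ι] {X : Set V}
    {p : V} (v : ι → V) (hv : ∀ i, v i ∈ X) (hp : p ∈ Submodule.span ℂ (Set.range v)) :
    HasRankLE X p (Nat.card ι) := by
  refine ⟨v ∘ (Finite.equivFin ι).symm, fun i => hv _, ?_⟩
  rwa [(Finite.equivFin ι).symm.surjective.range_comp]

theorem stmt10 {V : Type*} [AddCommGroup V] [Module ℂ V] [FiniteDimensional ℂ V]
    (X : Set V) (hX : X.Nonempty)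
    (hs : ∀ (c : ℂ), c ≠ 0 → ∀ x ∈ X, c • x ∈ X)
    (r : ℕ) (W : Submodule ℂ V) (hW : Module.finrank ℂ W = r + 1)
    (z : Fin (r + 1) → V) (hzX : ∀ i, z i ∈ X)
    (hzind : LinearIndependent ℂ z) (hzspan : Submodule.span ℂ (Set.range z) = W)
    (w : V) (hwX : w ∈ X) (hwW : w ∈ W)
    (c : Fin (r + 1) → ℂ) (hc : ∀ i, c i ≠ 0) (hw : w = ∑ i, c i • z i) :
    ∀ p, p ∈ W → p ≠ 0 →
      xrank (Xpow X (r + 1)) (tpow p (r + 1)) ≤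
        (r + 1) ^ (r + 1) - Nat.factorial (r + 1) + 1 := by
  classical
  intro p hp _
  rw [← hzspan, Submodule.mem_span_range_iff_exists_fun] at hp
  obtain ⟨a, rfl⟩ := hp
  let v : Option {f : Fin (r + 1) → Fin (r + 1) // ¬ Function.Bijective f} →
      ⨂[ℂ] _ : Fin (r + 1), V :=
    fun o => o.elim (tpow w (r + 1)) fun f => PiTensorProduct.tprod ℂ (fun j => z (f.1 j))
  have hv : ∀ o, v o ∈ Xpow X (r + 1) := by
    rintro (_ | f)
    · exact ⟨fun _ => w, fun _ => hwX, rfl⟩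
    · exact ⟨fun j => z (f.1 j), fun j => hzX _, rfl⟩
  have hspan : tpow (∑ i, a i • z i) (r + 1) ∈ Submodule.span ℂ (Set.range v) := by
    have hdiff : tpow (∑ i, a i • z i) (r + 1) - ((∏ i, a i) / ∏ i, c i) • tpow w (r + 1) ∈
        Submodule.span ℂ (Set.range v) := by
      rw [hw, tpow_sum_smul, tpow_sum_smul, Finset.smul_sum, ← Finset.sum_sub_distrib]
      refine Submodule.sum_mem _ fun f _ => ?_
      rw [smul_smul, ← sub_smul]
      by_cases hf : Function.Bijective f
      · rw [hf.prod_comp a, hf.prod_comp c,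
          div_mul_cancel₀ _ (Finset.prod_ne_zero_iff.mpr fun i _ => hc i), sub_self, zero_smul]
        exact Submodule.zero_mem _
      · exact Submodule.smul_mem _ _ (Submodule.subset_span ⟨some ⟨f, hf⟩, rfl⟩)
    rw [← sub_add_cancel (tpow (∑ i, a i • z i) (r + 1))
      (((∏ i, a i) / ∏ i, c i) • tpow w (r + 1))]
    exact Submodule.add_mem _ hdiff
      (Submodule.smul_mem _ _ (Submodule.subset_span ⟨none, rfl⟩))
  have hrank := HasRankLE.of_fintype v hv hspan
  rw [Finite.card_option, card_not_bijective] at hrank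
  exact Nat.sInf_le hrank
end
end

section
/- Let f be a nonzero homogeneous polynomial of degree d in two complex variables. Then the Waring border rank of f is strictly less than the Waring rank of f if and only if the product rank of f ⊗ f (with respect to elements ℓ1^d ⊗ ℓ2^d, ℓ1, ℓ2 linear forms in two variables) is strictly less than the square of the Waring rank of f. -/
open scoped TensorProduct

noncomputable section

/-- The linear form in two variables with coefficient vector `l`. -/
def linForm2 (l : Fin 2 → ℂ) : MvPolynomial (Fin 2) ℂ :=
  ∑ j, MvPolynomial.C (l j) * MvPolynomial.X j

/-- `f` is a linear combination of `r` `d`-th powers of linear forms in two variables,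
i.e. `f` has Waring rank at most `r`. -/
def WaringRankLE2 (d : ℕ) (f : MvPolynomial (Fin 2) ℂ) (r : ℕ) : Prop :=
  ∃ (c : Fin r → ℂ) (l : Fin r → Fin 2 → ℂ),
    f = ∑ s, MvPolynomial.C (c s) * (linForm2 (l s)) ^ d

/-- The Waring rank of a binary form of degree `d`. -/
def waringRank2 (d : ℕ) (f : MvPolynomial (Fin 2) ℂ) : ℕ :=
  sInf {r | WaringRankLE2 d f r}

/-- The canonical topology induced by all linear functionals; restricted to the
finite-dimensional space of forms of degree `d`, this is the natural Euclidean topology. -/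
def euclTop (V : Type*) [AddCommGroup V] [Module ℂ V] : TopologicalSpace V :=
  ⨅ f : V →ₗ[ℂ] ℂ, TopologicalSpace.induced (f : V → ℂ) inferInstance

/-- The Waring border rank of a binary form of degree `d`: the least `r` such that `f`
lies in the closure of the set of forms of Waring rank at most `r`. -/
def borderWaringRank2 (d : ℕ) (f : MvPolynomial (Fin 2) ℂ) : ℕ :=
  sInf {r | f ∈ @closure (MvPolynomial (Fin 2) ℂ) (euclTop (MvPolynomial (Fin 2) ℂ))
    {g | WaringRankLE2 d g r}}

/-- The product rank of a tensor in `Sym^{d1}(ℂ²) ⊗ Sym^{d2}(ℂ²)`: the least `r` such that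
it is a linear combination of `r` elements of the form `ℓ1^{d1} ⊗ ℓ2^{d2}`. -/
def prodRank2 (d1 d2 : ℕ) (t : MvPolynomial (Fin 2) ℂ ⊗[ℂ] MvPolynomial (Fin 2) ℂ) : ℕ :=
  sInf {r | ∃ (c : Fin r → ℂ) (l1 l2 : Fin r → Fin 2 → ℂ),
    t = ∑ s, c s • (((linForm2 (l1 s)) ^ d1 : MvPolynomial (Fin 2) ℂ) ⊗ₜ[ℂ]
      ((linForm2 (l2 s)) ^ d2 : MvPolynomial (Fin 2) ℂ))}


section BinaryForms

open Polynomial Finset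

/-- The exponent of the monomial `X₀ ^ (d - k) * X₁ ^ k`. -/
def binaryExponent (d k : ℕ) : Fin 2 →₀ ℕ :=
  Finsupp.single 0 (d - k) + Finsupp.single 1 k

/-- The apolarity pairing of binary forms of degree `d` with (dehomogenised) univariate
polynomials; the `d`-th power of `X₀ + β X₁` is sent to evaluation at `β` on polynomials of
degree at most `d`. -/
def apolarPairing (d : ℕ) : MvPolynomial (Fin 2) ℂ →ₗ[ℂ] ℂ[X] →ₗ[ℂ] ℂ :=
  ∑ k ∈ range (d + 1), ((d.choose k : ℂ)⁻¹) •
    (MvPolynomial.lcoeff ℂ (binaryExponent d k)).smulRight (Polynomial.lcoeff ℂ k)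

lemma apolarPairing_apply (d : ℕ) (f : MvPolynomial (Fin 2) ℂ) (p : ℂ[X]) :
    apolarPairing d f p = ∑ k ∈ range (d + 1),
      (d.choose k : ℂ)⁻¹ * (f.coeff (binaryExponent d k) * p.coeff k) := by
  simp [apolarPairing, LinearMap.sum_apply]

lemma binaryExponent_apply_one (d k : ℕ) : binaryExponent d k 1 = k := by
  simp [binaryExponent]

lemma coeff_linForm2_pow {d k : ℕ} (hk : k ≤ d) (l : Fin 2 → ℂ) :
    (linForm2 l ^ d).coeff (binaryExponent d k) = d.choose k * (l 0 ^ (d - k) * l 1 ^ k) := by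
  have key : linForm2 l ^ d = ∑ j ∈ range (d + 1),
      MvPolynomial.monomial (binaryExponent d j) (d.choose j * (l 0 ^ (d - j) * l 1 ^ j)) := by
    rw [linForm2, Fin.sum_univ_two, add_comm, add_pow]
    refine sum_congr rfl fun j _ => ?_
    rw [MvPolynomial.C_mul_X_eq_monomial, MvPolynomial.C_mul_X_eq_monomial,
      MvPolynomial.monomial_pow, MvPolynomial.monomial_pow, MvPolynomial.monomial_mul,
      ← map_natCast (MvPolynomial.C (σ := Fin 2) (R := ℂ)), mul_comm, MvPolynomial.C_mul_monomial]
    congr 1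
    · simp [binaryExponent, add_comm]
    · ring
  rw [key, MvPolynomial.coeff_sum, sum_eq_single k]
  · simp
  · intro j _ hj
    rw [MvPolynomial.coeff_monomial, if_neg]
    intro h
    apply hj
    rw [← binaryExponent_apply_one d j, h, binaryExponent_apply_one]
  · intro h
    simp at h
    omega

/-- The value at `l` of the homogenisation of `p` to degree `a`. -/
def homEval (a : ℕ) (p : ℂ[X]) (l : Fin 2 → ℂ) : ℂ :=
  ∑ k ∈ range (a + 1), p.coeff k * (l 0 ^ (a - k) * l 1 ^ k)

lemma apolarPairing_linForm2_pow (d : ℕ) (l : Fin 2 → ℂ) (p : ℂ[X]) :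
    apolarPairing d (linForm2 l ^ d) p = homEval d p l := by
  rw [apolarPairing_apply, homEval]
  refine sum_congr rfl fun k hk => ?_
  have hk : k ≤ d := by simpa [Nat.lt_succ_iff] using hk
  have : (d.choose k : ℂ) ≠ 0 := by exact_mod_cast (Nat.choose_pos hk).ne'
  rw [coeff_linForm2_pow hk]
  field_simp

lemma homEval_of_ne_zero {a : ℕ} {p : ℂ[X]} (hp : p.natDegree ≤ a) {l : Fin 2 → ℂ}
    (hl : l 0 ≠ 0) : homEval a p l = l 0 ^ a * p.eval (l 1 / l 0) := by
  rw [homEval, eval_eq_sum_range' (Nat.lt_succ_of_le hp), mul_sum]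
  refine sum_congr rfl fun k hk => ?_
  have hk : k ≤ a := by simpa [Nat.lt_succ_iff] using hk
  obtain ⟨b, rfl⟩ := Nat.exists_eq_add_of_le hk
  rw [Nat.add_sub_cancel_left, div_pow, pow_add]
  field_simp

lemma homEval_of_eq_zero (a : ℕ) (p : ℂ[X]) {l : Fin 2 → ℂ}
    (hl : l 0 = 0) : homEval a p l = p.coeff a * l 1 ^ a := by
  rw [homEval, sum_eq_single a]
  · simp
  · intro k hk hka
    have hk : k ≤ a := by simpa [Nat.lt_succ_iff] using hk
    rw [hl, zero_pow (by omega)]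
    simp
  · simp

lemma homEval_mul {a b : ℕ} {p q : ℂ[X]} (hp : p.natDegree ≤ a) (hq : q.natDegree ≤ b)
    (l : Fin 2 → ℂ) : homEval (a + b) (p * q) l = homEval a p l * homEval b q l := by
  by_cases hl : l 0 = 0
  · rw [homEval_of_eq_zero _ _ hl, homEval_of_eq_zero _ _ hl, homEval_of_eq_zero _ _ hl,
      coeff_mul_add_eq_of_natDegree_le hp hq]
    ring
  · rw [homEval_of_ne_zero (natDegree_mul_le_of_le hp hq) hl, homEval_of_ne_zero hp hl,
      homEval_of_ne_zero hq hl, eval_mul]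
    ring

lemma apolarPairing_linForm2_one_pow {d : ℕ} (β : ℂ) {p : ℂ[X]} (hp : p.natDegree ≤ d) :
    apolarPairing d (linForm2 ![1, β] ^ d) p = p.eval β := by
  rw [apolarPairing_linForm2_pow, homEval_of_ne_zero hp (by simp)]
  simp

lemma linForm2_pow_isHomogeneous (d : ℕ) (l : Fin 2 → ℂ) : (linForm2 l ^ d).IsHomogeneous d := by
  have h : (linForm2 l).IsHomogeneous 1 := by
    refine MvPolynomial.IsHomogeneous.sum _ _ _ fun j _ => ?_
    simpa using (MvPolynomial.isHomogeneous_C (Fin 2) (l j)).mul (MvPolynomial.isHomogeneous_X ℂ j)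
  simpa using h.pow d

/-- A binary form of degree `d` is determined by its apolarity pairing with polynomials of degree
at most `d`. -/
lemma eq_of_apolarPairing {d : ℕ} {f g : MvPolynomial (Fin 2) ℂ} (hf : f.IsHomogeneous d)
    (hg : g.IsHomogeneous d)
    (h : ∀ p : ℂ[X], p.natDegree ≤ d → apolarPairing d f p = apolarPairing d g p) : f = g := by
  ext m
  by_cases hm : m.degree = d
  · have hm' : m = binaryExponent d (m 1) := by
      have : m 0 + m 1 = d := by
        rw [← hm, Finsupp.degree_eq_sum, Fin.sum_univ_two]
      ext i
      fin_cases i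
      · simp [binaryExponent]
        omega
      · simp [binaryExponent]
    have hk : m 1 ≤ d := by
      rw [← hm]; exact Finsupp.le_degree _ _
    have := h (X ^ m 1) (by simpa using hk)
    have hc : (d.choose (m 1) : ℂ) ≠ 0 := by exact_mod_cast (Nat.choose_pos hk).ne'
    simpa [apolarPairing_apply, coeff_X_pow, Nat.lt_succ_iff, hk, hc, ← hm'] using this
  · rw [hf.coeff_eq_zero hm, hg.coeff_eq_zero hm]

end BinaryForms

section Pencils

open Polynomial Finset

/-- All but finitely many members of a pencil of univariate polynomials without common root
(not even at infinity) have only simple roots. -/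
lemma exists_finite_pencil_nodup_roots {N : ℕ} (hN : 1 ≤ N) {U V : ℂ[X]} (hU : U.natDegree ≤ N)
    (hV : V.natDegree ≤ N) (htop : U.coeff N ≠ 0 ∨ V.coeff N ≠ 0)
    (hroot : ∀ z, U.eval z = 0 → V.eval z ≠ 0) :
    ∃ S : Set ℂ, S.Finite ∧ ∀ t ∉ S, (U + C t * V).natDegree = N ∧ (U + C t * V).roots.Nodup := by
  have hcop : IsCoprime U V := by
    rw [isCoprime_iff_aeval_ne_zero_of_isAlgClosed ℂ ℂ]
    intro a
    by_cases h : U.eval a = 0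
    · right; simpa using hroot a h
    · left; simpa using h
  have hW : wronskian U V ≠ 0 := by
    intro h
    obtain ⟨h1, h2⟩ := hcop.wronskian_eq_zero_iff.mp h
    rw [derivative_eq_zero] at h1 h2
    rcases htop with h | h
    · exact h (coeff_eq_zero_of_natDegree_lt (by omega))
    · exact h (coeff_eq_zero_of_natDegree_lt (by omega))
  refine ⟨((fun z => -(U.eval z / V.eval z)) '' {z | (wronskian U V).IsRoot z}) ∪
    {-(U.coeff N / V.coeff N)}, ((finite_setOfPred_isRoot hW).image _).union (Set.finite_singleton _),
    fun t ht => ?_⟩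
  simp only [Set.mem_union, Set.mem_singleton_iff, not_or] at ht
  obtain ⟨ht1, ht2⟩ := ht
  have hcoeff : (U + C t * V).coeff N ≠ 0 := by
    rw [coeff_add, coeff_C_mul]
    intro h
    by_cases hVN : V.coeff N = 0
    · simp [hVN] at h
      simp [hVN, h] at htop
    · apply ht2
      rw [← neg_div, eq_div_iff hVN]
      linear_combination h
  have hne : U + C t * V ≠ 0 := by
    intro h
    simp [h] at hcoeff
  refine ⟨le_antisymm ?_ (le_natDegree_of_ne_zero hcoeff), ?_⟩
  · exact natDegree_add_le_of_degree_le hU ((natDegree_C_mul_le _ _).trans hV)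
  · rw [Multiset.nodup_iff_count_le_one]
    intro z
    rw [count_roots]
    by_contra! hz
    obtain ⟨h1, h2⟩ := (one_lt_rootMultiplicity_iff_isRoot hne).mp hz
    simp only [IsRoot, eval_add, eval_mul, eval_C, derivative_add, derivative_mul,
      derivative_C, zero_mul, zero_add] at h1 h2
    have hVz : V.eval z ≠ 0 := by
      intro h
      exact hroot z (by simpa [h] using h1) h
    refine ht1 ⟨z, ?_, ?_⟩
    · simp only [Set.mem_ofPred_eq, IsRoot, wronskian, eval_sub, eval_mul]
      linear_combination eval z (derivative V) * h1 - eval z V * h2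
    · simp only
      rw [← neg_div, div_eq_iff hVz]
      linear_combination -h1

/-- A linear functional vanishing on the multiples, of degree at most `d`, of a polynomial with
simple roots is a combination of the evaluations at these roots. -/
lemma eq_sum_eval_roots {d : ℕ} {q : ℂ[X]} (hq0 : q ≠ 0) (hq : q.roots.Nodup)
    (L : ℂ[X] →ₗ[ℂ] ℂ) (hL : ∀ s : ℂ[X], s.natDegree + q.natDegree ≤ d → L (q * s) = 0)
    {p : ℂ[X]} (hp : p.natDegree ≤ d) :
    L p = ∑ β ∈ q.roots.toFinset,
      L (Lagrange.basis q.roots.toFinset id β) * p.eval β := by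
  set B := q.roots.toFinset with hB
  have hcard : B.card = q.natDegree := by
    rw [hB, Multiset.toFinset_card_of_nodup hq, IsAlgClosed.card_roots_eq_natDegree]
  have hinj : Set.InjOn (id : ℂ → ℂ) B := Function.injective_id.injOn
  set I := Lagrange.interpolate B id fun β => p.eval β with hI
  have hIdeg : I.degree < B.card := Lagrange.degree_interpolate_lt _ hinj
  have hLI : L I = ∑ β ∈ B, L (Lagrange.basis B id β) * p.eval β := by
    rw [hI, Lagrange.interpolate_apply, map_sum]
    refine sum_congr rfl fun β _ => ?_
    rw [← smul_eq_C_mul, map_smul, smul_eq_mul, mul_comm]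
  have hdvd : q ∣ p - I := by
    by_cases hpI : p - I = 0
    · simp [hpI]
    refine (IsAlgClosed.splits q).dvd_of_roots_le_roots hq0 ?_
    rw [Multiset.le_iff_subset hq]
    intro β hβ
    rw [mem_roots hpI, IsRoot, eval_sub, sub_eq_zero]
    exact (Lagrange.eval_interpolate_at_node (fun β => p.eval β) hinj
      (Multiset.mem_toFinset.mpr hβ)).symm
  obtain ⟨s, hs⟩ := hdvd
  rw [← hLI, ← sub_eq_zero, ← map_sub, hs]
  by_cases hs0 : s = 0
  · simp [hs0]
  apply hL
  have h1 : (p - I).natDegree = q.natDegree + s.natDegree := by rw [hs, natDegree_mul hq0 hs0]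
  have h2 : (p - I).natDegree ≤ max p.natDegree I.natDegree := natDegree_sub_le _ _
  by_cases hI0 : I = 0
  · simp [hI0] at h2 h1
    omega
  · have h3 : I.natDegree < q.natDegree := by
      rw [← hcard]; exact (natDegree_lt_iff_degree_lt hI0).mpr hIdeg
    rcases le_max_iff.mp h2 with h | h <;> omega

/-- The evaluations at `d + 2` points satisfy a linear relation on polynomials of degree at most
`d`, with all coefficients nonzero. -/
lemma exists_eval_relation {d : ℕ} {B : Finset ℂ} (hB : B.card = d + 2) :
    ∃ w : ℂ → ℂ, (∀ β ∈ B, w β ≠ 0) ∧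
      ∀ p : ℂ[X], p.natDegree ≤ d → ∑ β ∈ B, w β * p.eval β = 0 := by
  refine ⟨fun β => (∏ γ ∈ B.erase β, (β - γ))⁻¹, fun β _ => ?_, fun p hp => ?_⟩
  · rw [ne_eq, inv_eq_zero, prod_eq_zero_iff]
    rintro ⟨γ, hγ, h⟩
    exact (mem_erase.mp hγ).1 (sub_eq_zero.mp h).symm
  · have h1 : p.degree < (B.card : WithBot ℕ) :=
      degree_le_natDegree.trans_lt (by exact_mod_cast (by omega : p.natDegree < B.card))
    have := Lagrange.coeff_eq_sum (v := id) Function.injective_id.injOn h1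
    rw [coeff_eq_zero_of_natDegree_lt (by omega)] at this
    rw [this]
    refine sum_congr rfl fun β _ => ?_
    simp [div_eq_mul_inv, mul_comm]

end Pencils

section ApolarGenerators

open Polynomial Finset

/-- `g`, regarded as a form of degree `r`, is apolar to the binary form `f` of degree `d`. -/
def IsApolar (d : ℕ) (f : MvPolynomial (Fin 2) ℂ) (r : ℕ) (g : ℂ[X]) : Prop :=
  g.natDegree ≤ r ∧ ∀ p : ℂ[X], p.natDegree + r ≤ d → apolarPairing d f (g * p) = 0

lemma natDegree_le_of_mem_degreeLT_succ {n : ℕ} {p : ℂ[X]} (hp : p ∈ degreeLT ℂ (n + 1)) :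
    p.natDegree ≤ n := by
  rw [mem_degreeLT] at hp
  by_cases h : p = 0
  · simp [h]
  · exact Nat.lt_succ_iff.mp ((natDegree_lt_iff_degree_lt h).mpr hp)

lemma linearMap_mul_eq_sum (L : ℂ[X] →ₗ[ℂ] ℂ) (h p : ℂ[X]) {r : ℕ} (hp : p.natDegree < r) :
    L (h * p) = ∑ j ∈ range r, p.coeff j * L (h * X ^ j) := by
  conv_lhs => rw [as_sum_range' p r hp]
  rw [mul_sum, map_sum]
  refine sum_congr rfl fun j _ => ?_
  rw [← C_mul_X_pow_eq_monomial, mul_left_comm, ← smul_eq_C_mul, map_smul, smul_eq_mul]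

lemma exists_ne_zero_isApolar {d r : ℕ} (f : MvPolynomial (Fin 2) ℂ) (hr : d + 1 ≤ 2 * r) :
    ∃ g ≠ 0, IsApolar d f r g := by
  let T : degreeLT ℂ (r + 1) →ₗ[ℂ] (Fin (d + 1 - r) → ℂ) :=
    LinearMap.pi fun j => apolarPairing d f ∘ₗ LinearMap.mulRight ℂ (X ^ (j : ℕ)) ∘ₗ
      (degreeLT ℂ (r + 1)).subtype
  have hT : LinearMap.ker T ≠ ⊥ := by
    have : FiniteDimensional ℂ (degreeLT ℂ (r + 1)) :=
      (degreeLTEquiv ℂ (r + 1)).symm.finiteDimensional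
    refine LinearMap.ker_ne_bot_of_finrank_lt ?_
    rw [(degreeLTEquiv ℂ (r + 1)).finrank_eq, Module.finrank_fin_fun, Module.finrank_fin_fun]
    omega
  obtain ⟨g, hg, hg0⟩ := Submodule.exists_mem_ne_zero_of_ne_bot hT
  refine ⟨g, by simpa using hg0, ?_, fun p hp => ?_⟩
  · exact natDegree_le_of_mem_degreeLT_succ g.2
  · rw [linearMap_mul_eq_sum (r := d + 1 - r) _ _ _ (by omega)]
    refine sum_eq_zero fun j hj => ?_
    have := congr_fun (LinearMap.mem_ker.mp hg) ⟨j, by simpa using hj⟩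
    simp only [T, LinearMap.pi_apply, LinearMap.comp_apply, LinearMap.mulRight_apply,
      Submodule.subtype_apply, Pi.zero_apply] at this
    rw [this, mul_zero]

/-- The lowest degree of an apolar form. -/
lemma exists_isApolar_minimal {d : ℕ} {f : MvPolynomial (Fin 2) ℂ} (hf : f ≠ 0)
    (hhom : f.IsHomogeneous d) :
    ∃ r g, g ≠ 0 ∧ IsApolar d f r g ∧ 1 ≤ r ∧ 2 * r ≤ d + 2 ∧
      ∀ g', IsApolar d f (r - 1) g' → g' = 0 := by
  classical
  have hex : ∃ r, ∃ g ≠ 0, IsApolar d f r g := ⟨_, exists_ne_zero_isApolar (r := d + 1) f (by omega)⟩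
  obtain ⟨g, hg0, hg⟩ := Nat.find_spec hex
  have h1 : 1 ≤ Nat.find hex := by
    by_contra! h
    rw [Nat.lt_one_iff.mp h] at hg
    obtain ⟨c, hc⟩ : ∃ c, C c = g := ⟨_, (eq_C_of_natDegree_le_zero hg.1).symm⟩
    have hc0 : c ≠ 0 := by
      rintro rfl
      simp at hc
      exact hg0 hc.symm
    refine hf (eq_of_apolarPairing hhom (MvPolynomial.isHomogeneous_zero _ _ d) fun p hp => ?_)
    have := hg.2 p (by omega)
    rw [← hc, ← smul_eq_C_mul, map_smul, smul_eq_mul] at this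
    simpa [hc0] using this
  refine ⟨Nat.find hex, g, hg0, hg, h1, ?_, fun g' hg' => ?_⟩
  · have := Nat.find_min' hex (exists_ne_zero_isApolar (r := d / 2 + 1) f (by omega))
    omega
  · by_contra h
    exact Nat.find_min hex (m := Nat.find hex - 1) (by omega) ⟨g', h, hg'⟩

lemma exists_apolarPairing_mul_X_pow {d r : ℕ} {f : MvPolynomial (Fin 2) ℂ} (hr1 : 1 ≤ r)
    (hrd : r ≤ d + 1) (hmin : ∀ g, IsApolar d f (r - 1) g → g = 0) (v : Fin r → ℂ) :
    ∃ h : ℂ[X], h.natDegree + r ≤ d + 1 ∧ ∀ j : Fin r, apolarPairing d f (h * X ^ (j : ℕ)) = v j := by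
  let T : degreeLT ℂ (d + 1 - r + 1) →ₗ[ℂ] (Fin r → ℂ) :=
    LinearMap.pi fun j => apolarPairing d f ∘ₗ LinearMap.mulRight ℂ (X ^ (j : ℕ)) ∘ₗ
      (degreeLT ℂ (d + 1 - r + 1)).subtype
  have hT : Function.Surjective T := by
    rw [← LinearMap.dualMap_injective_iff, injective_iff_map_eq_zero]
    intro φ hφ
    set g : ℂ[X] := ∑ j : Fin r, C (φ (Pi.single j 1)) * X ^ (j : ℕ) with hg
    have hdeg : g.natDegree ≤ r - 1 := by
      refine natDegree_sum_le_of_forall_le _ _ fun j _ => ?_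
      exact (natDegree_C_mul_X_pow_le _ _).trans (by omega)
    have hg0 : g = 0 := by
      refine hmin g ⟨hdeg, fun p hp => ?_⟩
      have hp' : p ∈ degreeLT ℂ (d + 1 - r + 1) := by
        rw [mem_degreeLT]
        exact degree_le_natDegree.trans_lt (by exact_mod_cast (by omega))
      have h1 := LinearMap.congr_fun hφ ⟨p, hp'⟩
      rw [LinearMap.dualMap_apply, LinearMap.pi_apply_eq_sum_univ φ] at h1
      rw [LinearMap.zero_apply] at h1
      rw [hg, sum_mul, map_sum, ← h1]
      refine sum_congr rfl fun j _ => ?_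
      rw [mul_assoc, ← smul_eq_C_mul, map_smul, smul_eq_mul, smul_eq_mul, mul_comm, mul_comm _ p]
      simp only [T, LinearMap.pi_apply, LinearMap.comp_apply, LinearMap.mulRight_apply,
        Submodule.subtype_apply]
      congr 2
      funext i
      simp [Pi.single_apply, eq_comm]
    apply LinearMap.pi_ext'
    intro j
    ext
    have := congr_arg (fun q : ℂ[X] => q.coeff j) hg0
    simpa [hg, finsetSum_coeff, coeff_X_pow, Fin.val_inj] using this
  obtain ⟨h, hh⟩ := hT v
  refine ⟨h, ?_, fun j => congr_fun hh j⟩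
  have : (h : ℂ[X]).natDegree ≤ d + 1 - r :=
    natDegree_le_of_mem_degreeLT_succ h.2
  omega

end ApolarGenerators

section LowerBounds

open Polynomial Finset

lemma card_le_of_det_ne_zero {ι : Type*} [Fintype ι] [DecidableEq ι] {N : ℕ} {M : Matrix ι ι ℂ}
    (u v : Fin N → ι → ℂ) (hM : ∀ i j, M i j = ∑ s, u s i * v s j) (hdet : M.det ≠ 0) :
    Fintype.card ι ≤ N := by
  have hfac : M = (Matrix.of fun i s => u s i) * (Matrix.of v) := by
    ext i j
    rw [hM, Matrix.mul_apply]
    rfl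
  have hrank : M.rank = Fintype.card ι :=
    Matrix.rank_of_isUnit M ((Matrix.isUnit_iff_isUnit_det M).mpr hdet.isUnit)
  calc Fintype.card ι = M.rank := hrank.symm
    _ ≤ (Matrix.of fun i s => u s i).rank := by rw [hfac]; exact Matrix.rank_mul_le_left _ _
    _ ≤ N := by simpa using Matrix.rank_le_card_width (Matrix.of fun (i : ι) (s : Fin N) => u s i)

lemma apolarPairing_linForm2_pow_mul {d a b : ℕ} (hab : a + b = d) {p q : ℂ[X]}
    (hp : p.natDegree ≤ a) (hq : q.natDegree ≤ b) (l : Fin 2 → ℂ) :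
    apolarPairing d (linForm2 l ^ d) (p * q) = homEval a p l * homEval b q l := by
  rw [apolarPairing_linForm2_pow, ← hab, homEval_mul hp hq]

variable {d r : ℕ} {f : MvPolynomial (Fin 2) ℂ}

lemma exists_apolarPairing_dual (hr1 : 1 ≤ r)
    (hrd : r ≤ d + 1) (hmin : ∀ g, IsApolar d f (r - 1) g → g = 0) :
    ∃ h : Fin r → ℂ[X], (∀ i, (h i).natDegree ≤ d + 1 - r) ∧
      ∀ i j : Fin r, apolarPairing d f (h i * X ^ (j : ℕ)) = (1 : Matrix (Fin r) (Fin r) ℂ) i j := by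
  choose h h1 h2 using fun i : Fin r =>
    exists_apolarPairing_mul_X_pow hr1 hrd hmin ((1 : Matrix (Fin r) (Fin r) ℂ) i)
  exact ⟨h, fun i => by have := h1 i; omega, h2⟩

lemma continuous_euclTop {V : Type*} [AddCommGroup V] [Module ℂ V] (φ : V →ₗ[ℂ] ℂ) :
    @Continuous V ℂ (euclTop V) _ φ :=
  continuous_iInf_dom (i := φ) continuous_induced_dom

/-- The catalecticant lower bound for the border rank. -/
lemma le_of_mem_closure_waringRankLE2 (hr1 : 1 ≤ r)
    (hrd : r ≤ d + 1) (hmin : ∀ g, IsApolar d f (r - 1) g → g = 0) {ρ : ℕ}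
    (hf : f ∈ @closure (MvPolynomial (Fin 2) ℂ) (euclTop (MvPolynomial (Fin 2) ℂ))
      {g | WaringRankLE2 d g ρ}) : r ≤ ρ := by
  obtain ⟨h, hdeg, hdual⟩ := exists_apolarPairing_dual hr1 hrd hmin
  by_contra! hlt
  let M : MvPolynomial (Fin 2) ℂ → Matrix (Fin r) (Fin r) ℂ := fun g =>
    Matrix.of fun i j => apolarPairing d g (h i * X ^ (j : ℕ))
  let _ : TopologicalSpace (MvPolynomial (Fin 2) ℂ) := euclTop _
  have hcont : Continuous fun g => (M g).det := by
    refine Continuous.matrix_det (continuous_matrix fun i j => ?_)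
    exact continuous_euclTop ((apolarPairing d).flip (h i * X ^ (j : ℕ)))
  have hsub : {g | WaringRankLE2 d g ρ} ⊆ {g | (M g).det = 0} := by
    rintro _ ⟨c, l, rfl⟩
    by_contra hdet
    have := card_le_of_det_ne_zero (N := ρ)
      (fun s i => c s * homEval (d + 1 - r) (h i) (l s))
      (fun s j => homEval (r - 1) (X ^ (j : ℕ)) (l s)) (fun i j => ?_) hdet
    · simp at this
      omega
    · simp only [M, Matrix.of_apply, map_sum, LinearMap.sum_apply]
      refine sum_congr rfl fun s _ => ?_
      rw [← MvPolynomial.smul_eq_C_mul, map_smul, LinearMap.smul_apply, smul_eq_mul,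
        apolarPairing_linForm2_pow_mul (a := d + 1 - r) (b := r - 1) (by omega) (hdeg i)
          (by simp; omega), mul_assoc]
  have h0 : (M f).det = 0 := closure_minimal hsub (isClosed_eq hcont continuous_const) hf
  have h1 : M f = 1 := by
    ext i j
    exact hdual i j
  rw [h1, Matrix.det_one] at h0
  exact one_ne_zero h0

/-- The catalecticant lower bound for the product rank of `f ⊗ f`. -/
lemma sq_le_of_tmul_self_eq_sum (hr1 : 1 ≤ r)
    (hrd : r ≤ d + 1) (hmin : ∀ g, IsApolar d f (r - 1) g → g = 0) {N : ℕ}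
    (c : Fin N → ℂ) (l1 l2 : Fin N → Fin 2 → ℂ)
    (hf : f ⊗ₜ[ℂ] f = ∑ s, c s • (((linForm2 (l1 s)) ^ d : MvPolynomial (Fin 2) ℂ) ⊗ₜ[ℂ]
      ((linForm2 (l2 s)) ^ d : MvPolynomial (Fin 2) ℂ))) : r ^ 2 ≤ N := by
  obtain ⟨h, hdeg, hdual⟩ := exists_apolarPairing_dual hr1 hrd hmin
  let φ : Fin r → Fin r → MvPolynomial (Fin 2) ℂ →ₗ[ℂ] ℂ := fun i j =>
    (apolarPairing d).flip (h i * X ^ (j : ℕ))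
  let ψ : Fin r × Fin r → Fin r × Fin r →
      MvPolynomial (Fin 2) ℂ ⊗[ℂ] MvPolynomial (Fin 2) ℂ →ₗ[ℂ] ℂ := fun i j =>
    LinearMap.mul' ℂ ℂ ∘ₗ TensorProduct.map (φ i.1 j.1) (φ i.2 j.2)
  have hψ : ∀ i j a b, ψ i j (a ⊗ₜ b) = φ i.1 j.1 a * φ i.2 j.2 b := fun i j a b => by simp [ψ]
  let M : Matrix (Fin r × Fin r) (Fin r × Fin r) ℂ := Matrix.of fun i j => ψ i j (f ⊗ₜ f)
  have hM : M = 1 := by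
    ext i j
    simp only [M, Matrix.of_apply, hψ, φ, LinearMap.flip_apply, hdual]
    simp only [Matrix.one_apply, Prod.ext_iff]
    split_ifs <;> simp_all
  have := card_le_of_det_ne_zero (M := M)
    (fun s i => c s * (homEval (d + 1 - r) (h i.1) (l1 s) * homEval (d + 1 - r) (h i.2) (l2 s)))
    (fun s j => homEval (r - 1) (X ^ (j.1 : ℕ)) (l1 s) * homEval (r - 1) (X ^ (j.2 : ℕ)) (l2 s))
    (fun i j => ?_) (by rw [hM, Matrix.det_one]; exact one_ne_zero)
  · simpa [sq] using this
  · simp only [M, Matrix.of_apply, hf, map_sum]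
    refine sum_congr rfl fun s _ => ?_
    rw [map_smul, hψ]
    simp only [φ, LinearMap.flip_apply]
    rw [apolarPairing_linForm2_pow_mul (a := d + 1 - r) (b := r - 1) (by omega) (hdeg _)
        (by simp; omega),
      apolarPairing_linForm2_pow_mul (a := d + 1 - r) (b := r - 1) (by omega) (hdeg _)
        (by simp; omega), smul_eq_mul]
    ring

end LowerBounds

section Decompositions

open Finset

lemma waringRankLE2_sum {ι : Type*} (d : ℕ) (s : Finset ι) (c : ι → ℂ) (l : ι → Fin 2 → ℂ) :
    WaringRankLE2 d (∑ i ∈ s, MvPolynomial.C (c i) * linForm2 (l i) ^ d) s.card := by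
  refine ⟨fun j => c (s.equivFin.symm j), fun j => l (s.equivFin.symm j), ?_⟩
  rw [← sum_coe_sort s, ← s.equivFin.symm.sum_comp]

/-- `t` is a linear combination of `r` elements `ℓ₁ ^ d₁ ⊗ ℓ₂ ^ d₂`. -/
def ProdRankLE2 (d1 d2 : ℕ) (t : MvPolynomial (Fin 2) ℂ ⊗[ℂ] MvPolynomial (Fin 2) ℂ)
    (r : ℕ) : Prop :=
  ∃ (c : Fin r → ℂ) (l1 l2 : Fin r → Fin 2 → ℂ),
    t = ∑ s, c s • (((linForm2 (l1 s)) ^ d1 : MvPolynomial (Fin 2) ℂ) ⊗ₜ[ℂ]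
      ((linForm2 (l2 s)) ^ d2 : MvPolynomial (Fin 2) ℂ))

variable {d d1 d2 : ℕ}

lemma ProdRankLE2.add {t t' : MvPolynomial (Fin 2) ℂ ⊗[ℂ] MvPolynomial (Fin 2) ℂ} {r r' : ℕ}
    (h : ProdRankLE2 d1 d2 t r) (h' : ProdRankLE2 d1 d2 t' r') :
    ProdRankLE2 d1 d2 (t + t') (r + r') := by
  obtain ⟨c, l1, l2, rfl⟩ := h
  obtain ⟨c', l1', l2', rfl⟩ := h'
  exact ⟨Fin.append c c', Fin.append l1 l1', Fin.append l2 l2', by simp [Fin.sum_univ_add]⟩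

lemma ProdRankLE2.smul {t : MvPolynomial (Fin 2) ℂ ⊗[ℂ] MvPolynomial (Fin 2) ℂ} {r : ℕ}
    (h : ProdRankLE2 d1 d2 t r) (a : ℂ) : ProdRankLE2 d1 d2 (a • t) r := by
  obtain ⟨c, l1, l2, rfl⟩ := h
  exact ⟨fun s => a * c s, l1, l2, by simp [smul_sum, smul_smul]⟩

lemma ProdRankLE2.sum {ι : Type*} (s : Finset ι)
    {t : ι → MvPolynomial (Fin 2) ℂ ⊗[ℂ] MvPolynomial (Fin 2) ℂ} {r : ℕ}
    (h : ∀ i ∈ s, ProdRankLE2 d1 d2 (t i) r) : ProdRankLE2 d1 d2 (∑ i ∈ s, t i) (s.card * r) := by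
  classical
  induction s using Finset.induction_on with
  | empty => exact ⟨fun _ => 0, fun _ => 0, fun _ => 0, by simp⟩
  | insert a s ha ih =>
    rw [sum_insert ha, card_insert_of_notMem ha, add_mul, one_mul, add_comm]
    exact (ih fun i hi => h i (mem_insert_of_mem hi)).add (h a (mem_insert_self a s))

lemma WaringRankLE2.tmul_linForm2_pow {f : MvPolynomial (Fin 2) ℂ} {r : ℕ}
    (h : WaringRankLE2 d1 f r) (l : Fin 2 → ℂ) :
    ProdRankLE2 d1 d2 (f ⊗ₜ[ℂ] (linForm2 l ^ d2 : MvPolynomial (Fin 2) ℂ)) r := by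
  obtain ⟨c, m, rfl⟩ := h
  refine ⟨c, m, fun _ => l, ?_⟩
  simp only [TensorProduct.sum_tmul, ← MvPolynomial.smul_eq_C_mul, TensorProduct.smul_tmul']

lemma WaringRankLE2.linForm2_pow_tmul {f : MvPolynomial (Fin 2) ℂ} {r : ℕ}
    (h : WaringRankLE2 d2 f r) (l : Fin 2 → ℂ) :
    ProdRankLE2 d1 d2 ((linForm2 l ^ d1 : MvPolynomial (Fin 2) ℂ) ⊗ₜ[ℂ] f) r := by
  obtain ⟨c, m, rfl⟩ := h
  refine ⟨c, fun _ => l, m, ?_⟩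
  simp only [TensorProduct.tmul_sum, ← MvPolynomial.smul_eq_C_mul, TensorProduct.tmul_smul]

lemma WaringRankLE2.tmul {f g : MvPolynomial (Fin 2) ℂ} {r r' : ℕ}
    (h : WaringRankLE2 d1 f r) (h' : WaringRankLE2 d2 g r') :
    ProdRankLE2 d1 d2 (f ⊗ₜ[ℂ] g) (r' * r) := by
  obtain ⟨c, m, rfl⟩ := h'
  simp only [TensorProduct.tmul_sum, ← MvPolynomial.smul_eq_C_mul, TensorProduct.tmul_smul]
  simpa using ProdRankLE2.sum univ fun i _ => (h.tmul_linForm2_pow (m i)).smul (c i)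

end Decompositions

section ApolarDecompositions

open Polynomial Finset

variable {d r : ℕ} {f : MvPolynomial (Fin 2) ℂ} {g : ℂ[X]}

lemma linForm2_smul_pow (d : ℕ) (a : ℂ) (l : Fin 2 → ℂ) :
    linForm2 (a • l) ^ d = MvPolynomial.C (a ^ d) * linForm2 l ^ d := by
  rw [map_pow, ← mul_pow, linForm2, linForm2, mul_sum]
  simp [mul_assoc]

/-- Every decomposition as a sum of powers can be rewritten with powers of pairwise distinct forms
`X₀ + β X₁`, and a multiple of the power of `X₁`. -/
lemma WaringRankLE2.exists_affine {k : ℕ} (hf : WaringRankLE2 d f k) :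
    ∃ (T : Finset ℂ) (γ : ℂ → ℂ) (c : ℂ), (∀ β ∈ T, γ β ≠ 0) ∧
      T.card + (if c = 0 then 0 else 1) ≤ k ∧
      f = ∑ β ∈ T, MvPolynomial.C (γ β) * linForm2 ![1, β] ^ d +
        MvPolynomial.C c * linForm2 ![0, 1] ^ d := by
  classical
  obtain ⟨c, l, rfl⟩ := hf
  let I : Finset (Fin k) := univ.filter fun s => l s 0 ≠ 0
  let γ : ℂ → ℂ := fun β => ∑ s ∈ I with l s 1 / l s 0 = β, c s * l s 0 ^ d
  let T₀ : Finset ℂ := I.image fun s => l s 1 / l s 0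
  have hcard : #I + #(univ.filter fun s => ¬ l s 0 ≠ 0) = k := by
    simpa [I] using card_filter_add_card_filter_not (s := univ) fun s => l s 0 ≠ 0
  have hT₀ : #T₀ ≤ #I := card_image_le
  refine ⟨T₀.filter fun β => γ β ≠ 0, γ, ∑ s with ¬ l s 0 ≠ 0, c s * l s 1 ^ d,
    fun β hβ => (mem_filter.mp hβ).2, ?_, ?_⟩
  · have := card_filter_le T₀ fun β => γ β ≠ 0
    split_ifs with h
    · omega
    · have : (univ.filter fun s => ¬ l s 0 ≠ 0).Nonempty := by
        rw [nonempty_iff_ne_empty]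
        intro h0
        rw [h0] at h
        simp at h
      have := this.card_pos
      omega
  · rw [← sum_filter_add_sum_filter_not univ fun s => l s 0 ≠ 0]
    congr 1
    · rw [sum_filter_of_ne (p := fun β => γ β ≠ 0)
        (f := fun β => MvPolynomial.C (γ β) * linForm2 ![1, β] ^ d)
        (fun β _ hβ h => hβ (by simp [h])),
        ← sum_fiberwise_of_maps_to (fun s hs => mem_image_of_mem (fun s => l s 1 / l s 0) hs)]
      refine sum_congr rfl fun β _ => ?_
      rw [map_sum, sum_mul]
      refine sum_congr rfl fun s hs => ?_
      obtain ⟨hsI, rfl⟩ := mem_filter.mp hs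
      have hs0 : l s 0 ≠ 0 := (mem_filter.mp hsI).2
      have : l s = l s 0 • ![1, l s 1 / l s 0] := by
        ext i
        fin_cases i
        · simp
        · simp [mul_div_cancel₀ _ hs0]
      conv_lhs => rw [this, linForm2_smul_pow, ← mul_assoc, ← map_mul]
    · rw [map_sum, sum_mul]
      refine sum_congr rfl fun s hs => ?_
      have hs0 : l s 0 = 0 := by simpa using (mem_filter.mp hs).2
      have : l s = l s 1 • ![0, 1] := by
        ext i
        fin_cases i
        · simpa using hs0
        · simp
      conv_lhs => rw [this, linForm2_smul_pow, ← mul_assoc, ← map_mul]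

/-- If a form `g` of degree `r` is apolar to `f`, then a decomposition of `f` with at most
`d + 1 - r` terms is supported on the roots of `g`. -/
lemma IsApolar.waringRankLE2_of_le (hg0 : g ≠ 0) (hg : IsApolar d f r g) (hr : 1 ≤ r) {k : ℕ}
    (hk : k + r ≤ d + 1) (hf : WaringRankLE2 d f k) : ∃ k' ≤ r, WaringRankLE2 d f k' := by
  classical
  obtain ⟨T, γ, c, hγ, hcard, hsum⟩ := hf.exists_affine
  have hpair : ∀ p : ℂ[X], p.natDegree ≤ d → apolarPairing d f p =
      ∑ β ∈ T, γ β * p.eval β + c * p.coeff d := by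
    intro p hp
    rw [hsum, map_add, map_sum, LinearMap.add_apply, LinearMap.sum_apply]
    congr 1
    · refine sum_congr rfl fun β _ => ?_
      rw [← MvPolynomial.smul_eq_C_mul, map_smul, LinearMap.smul_apply, smul_eq_mul,
        apolarPairing_linForm2_one_pow β hp]
    · rw [← MvPolynomial.smul_eq_C_mul, map_smul, LinearMap.smul_apply, smul_eq_mul,
        apolarPairing_linForm2_pow, homEval_of_eq_zero _ _ (by simp)]
      simp
  have hroots : ∀ β ∈ T, g.eval β = 0 := by
    intro β hβ
    set p : ℂ[X] := ∏ x ∈ T.erase β, (X - C x) with hp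
    have hpdeg : p.natDegree = T.card - 1 := by
      rw [hp, natDegree_finsetProd_X_sub_C_eq_card, card_erase_of_mem hβ]
    have hTpos : 0 < T.card := card_pos.mpr ⟨β, hβ⟩
    have hgp : (g * p).natDegree ≤ r + (T.card - 1) := natDegree_mul_le_of_le hg.1 hpdeg.le
    have h0 := hg.2 p (by split_ifs at hcard <;> omega)
    rw [hpair _ (by split_ifs at hcard <;> omega), sum_eq_single_of_mem β hβ] at h0
    · have hc : c * (g * p).coeff d = 0 := by
        by_cases hc : c = 0
        · simp [hc]
        · rw [coeff_eq_zero_of_natDegree_lt, mul_zero]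
          simp only [hc, if_false] at hcard
          omega
      have hpβ : p.eval β ≠ 0 := by
        rw [hp, eval_prod, prod_ne_zero_iff]
        intro x hx
        simpa [sub_eq_zero] using (mem_erase.mp hx).1.symm
      rw [hc, add_zero, eval_mul] at h0
      simpa [hγ β hβ, hpβ] using h0
    · intro x hx hxβ
      have : p.eval x = 0 := by
        rw [hp, eval_prod]
        exact prod_eq_zero (mem_erase.mpr ⟨hxβ, hx⟩) (by simp)
      simp [this]
  have hTg : T.card ≤ g.natDegree := by
    refine le_trans (card_le_card ?_) ((Multiset.toFinset_card_le _).trans (card_roots' g))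
    intro β hβ
    simpa [hg0] using hroots β hβ
  by_cases hc : c = 0
  · refine ⟨T.card, hTg.trans hg.1, ?_⟩
    rw [hsum, hc]
    simpa using waringRankLE2_sum d T γ fun β => ![1, β]
  · simp only [hc, if_false] at hcard
    refine ⟨T.card + 1, ?_, ?_⟩
    · by_contra! hlt
      have hgr : g.natDegree = r := by have := hg.1; omega
      set p : ℂ[X] := (∏ x ∈ T, (X - C x)) * X ^ (d - r - T.card) with hp
      have hpm : p.Monic := (monic_prod_of_monic _ _ fun x _ => monic_X_sub_C x).mul (monic_X_pow _)
      have hpdeg : p.natDegree = d - r := by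
        rw [hp, (monic_prod_of_monic _ _ fun x _ => monic_X_sub_C x).natDegree_mul (monic_X_pow _),
          natDegree_finsetProd_X_sub_C_eq_card, natDegree_X_pow]
        omega
      have h0 := hg.2 p (by omega)
      rw [hpair _ (natDegree_mul_le_of_le hg.1 hpdeg.le |>.trans (by omega)), sum_eq_zero] at h0
      · have hcoeff : (g * p).coeff d = g.coeff r * p.coeff (d - r) := by
          rw [← coeff_mul_add_eq_of_natDegree_le hg.1 hpdeg.le]
          congr 1
          omega
        rw [hcoeff, ← hpdeg, hpm.coeff_natDegree, ← hgr, coeff_natDegree] at h0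
        simp [hc, hg0] at h0
      · intro β hβ
        simp [hroots β hβ]
    · refine ⟨Fin.cons c fun j => γ (T.equivFin.symm j),
        Fin.cons ![0, 1] fun j => ![1, (T.equivFin.symm j : ℂ)], ?_⟩
      rw [Fin.sum_univ_succ]
      simp only [Fin.cons_zero, Fin.cons_succ]
      rw [hsum, add_comm]
      congr 1
      rw [← sum_coe_sort T, ← T.equivFin.symm.sum_comp]

/-- A binary form apolar to a polynomial with simple roots is a combination of powers of the
linear forms given by the roots. -/
lemma IsApolar.exists_sum_roots {N : ℕ} {q : ℂ[X]} (hf : f.IsHomogeneous d)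
    (hq : IsApolar d f N q) (hN : 1 ≤ N) (hdeg : q.natDegree = N) (hnodup : q.roots.Nodup) :
    ∃ (B : Finset ℂ) (c : ℂ → ℂ), B.card = N ∧
      f = ∑ β ∈ B, MvPolynomial.C (c β) * linForm2 ![1, β] ^ d := by
  have hq0 : q ≠ 0 := by
    rintro rfl
    simp at hdeg
    omega
  refine ⟨q.roots.toFinset, fun β => apolarPairing d f (Lagrange.basis q.roots.toFinset id β),
    ?_, ?_⟩
  · rw [Multiset.toFinset_card_of_nodup hnodup, IsAlgClosed.card_roots_eq_natDegree, hdeg]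
  · refine eq_of_apolarPairing hf (MvPolynomial.IsHomogeneous.sum _ _ _ fun β _ => ?_) fun p hp => ?_
    · exact (linForm2_pow_isHomogeneous d _).C_mul _
    · rw [eq_sum_eval_roots hq0 hnodup _ (fun s hs => hq.2 s (by omega)) hp, map_sum,
        LinearMap.sum_apply]
      refine sum_congr rfl fun β _ => ?_
      rw [← MvPolynomial.smul_eq_C_mul, map_smul, LinearMap.smul_apply, smul_eq_mul,
        apolarPairing_linForm2_one_pow β hp]

/-- If `g` is an apolar form of lowest degree and `g e ≠ 0`, there is `h`, without common root
with `g` (not even at infinity), which contracts `f` to a power of the linear form of `e`. -/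
lemma IsApolar.exists_contraction (hg : IsApolar d f r g)
    (hr1 : 1 ≤ r) (hrd : r ≤ d + 1) (hmin : ∀ g', IsApolar d f (r - 1) g' → g' = 0) {e : ℂ}
    (he : g.eval e ≠ 0) :
    ∃ h : ℂ[X], h.natDegree ≤ d + 1 - r ∧
      (∀ q : ℂ[X], q.natDegree < r → apolarPairing d f (h * q) = q.eval e) ∧
      (∀ z, h.eval z = 0 → g.eval z ≠ 0) ∧ (h.coeff (d + 1 - r) ≠ 0 ∨ g.coeff r ≠ 0) := by
  obtain ⟨h, hdeg, hh⟩ := exists_apolarPairing_mul_X_pow hr1 hrd hmin fun j => e ^ (j : ℕ)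
  have hpair : ∀ q : ℂ[X], q.natDegree < r → apolarPairing d f (h * q) = q.eval e := by
    intro q hq
    rw [linearMap_mul_eq_sum _ _ _ hq, eval_eq_sum_range' hq]
    refine sum_congr rfl fun j hj => ?_
    rw [hh ⟨j, mem_range.mp hj⟩]
  refine ⟨h, by omega, hpair, fun z hhz hgz => ?_, ?_⟩
  · obtain ⟨h', rfl⟩ := dvd_iff_isRoot.mpr hhz
    obtain ⟨g', rfl⟩ := dvd_iff_isRoot.mpr hgz
    have hg'0 : g' ≠ 0 := by
      rintro rfl
      simp at he
    have hg'deg : ((X - C z) * g').natDegree = g'.natDegree + 1 := by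
      rw [natDegree_mul (X_sub_C_ne_zero z) hg'0, natDegree_X_sub_C, add_comm]
    have h1 := hpair g' (by have := hg.1; omega)
    by_cases hh'0 : h' = 0
    · rw [hh'0, mul_zero, zero_mul, map_zero] at h1
      simp [← h1] at he
    have hh'deg : ((X - C z) * h').natDegree = h'.natDegree + 1 := by
      rw [natDegree_mul (X_sub_C_ne_zero z) hh'0, natDegree_X_sub_C, add_comm]
    have h2 := hg.2 h' (by omega)
    rw [mul_right_comm, h1] at h2
    simp [h2] at he
  · by_contra! hcon
    have hgdeg : g.natDegree < r := by
      refine lt_of_le_of_ne hg.1 fun hgr => ?_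
      rw [← hgr, coeff_natDegree, leadingCoeff_eq_zero] at hcon
      simp [hcon.2] at he
    have h1 := hpair g hgdeg
    rw [mul_comm] at h1
    refine he (h1.symm.trans ?_)
    by_cases hh0 : h = 0
    · simp [hh0]
    refine hg.2 h ?_
    have : h.natDegree ≠ d + 1 - r := by
      intro heq
      rw [← heq, coeff_natDegree, leadingCoeff_eq_zero] at hcon
      exact hh0 hcon.1
    omega

end ApolarDecompositions

section Comparison

open Polynomial Finset

variable {d r : ℕ} {f : MvPolynomial (Fin 2) ℂ} {g : ℂ[X]}

lemma exists_eval_ne_zero_complex {p : ℂ[X]} (hp : p ≠ 0) : ∃ z, p.eval z ≠ 0 :=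
  (finite_setOfPred_isRoot hp).infinite_compl.nonempty

lemma IsApolar.waringRankLE2_of_eq (hf : f.IsHomogeneous d) (hg0 : g ≠ 0) (hg : IsApolar d f r g)
    (hr1 : 1 ≤ r) (hrd : 2 * r = d + 2) (hmin : ∀ g', IsApolar d f (r - 1) g' → g' = 0) :
    WaringRankLE2 d f r := by
  obtain ⟨e, he⟩ := exists_eval_ne_zero_complex hg0
  obtain ⟨h, hdeg, hpair, hroot, htop⟩ := hg.exists_contraction hr1 (by omega) hmin he
  have hU : ((X - C e) * h).natDegree ≤ r :=
    (natDegree_mul_le_of_le (natDegree_X_sub_C_le e) hdeg).trans (by omega)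
  obtain ⟨S, hS, hpencil⟩ := exists_finite_pencil_nodup_roots hr1 hU hg.1
    (by
      have := coeff_mul_add_eq_of_natDegree_le (natDegree_X_sub_C_le e) hdeg
      rw [show 1 + (d + 1 - r) = r by omega] at this
      rw [this]
      simpa [coeff_X, coeff_C] using htop)
    (fun z hz => by
      rw [eval_mul, mul_eq_zero] at hz
      rcases hz with hz | hz
      · rw [eval_sub, eval_X, eval_C, sub_eq_zero] at hz
        rwa [hz]
      · exact hroot z hz)
  obtain ⟨t, ht⟩ := hS.infinite_compl.nonempty
  obtain ⟨hN, hnodup⟩ := hpencil t ht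
  have hap : IsApolar d f r ((X - C e) * h + C t * g) := by
    refine ⟨hN.le, fun q hq => ?_⟩
    rw [add_mul, map_add, mul_assoc (C t), ← smul_eq_C_mul, map_smul, hg.2 q hq,
      mul_comm (X - C e) h, mul_assoc, hpair]
    · simp
    · have : ((X - C e) * q).natDegree ≤ 1 + q.natDegree :=
        natDegree_mul_le_of_le (natDegree_X_sub_C_le e) le_rfl
      omega
  obtain ⟨B, c, hB, hsum⟩ := hap.exists_sum_roots hf hr1 hN hnodup
  rw [hsum, ← hB]
  exact waringRankLE2_sum d B c fun β => ![1, β]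

/-- Adding almost any multiple of a suitable power of a linear form to `f` yields a form of rank
at most `d + 1 - r`. -/
lemma IsApolar.exists_perturbation (hf : f.IsHomogeneous d) (hg0 : g ≠ 0) (hg : IsApolar d f r g)
    (hr1 : 1 ≤ r) (hrd : 2 * r ≤ d + 1) (hmin : ∀ g', IsApolar d f (r - 1) g' → g' = 0) :
    ∃ (e : ℂ) (S : Set ℂ), S.Finite ∧ ∀ a ∉ S, ∃ (B : Finset ℂ) (c : ℂ → ℂ),
      B.card = d + 1 - r ∧ f + MvPolynomial.C a * linForm2 ![1, e] ^ d =
        ∑ β ∈ B, MvPolynomial.C (c β) * linForm2 ![1, β] ^ d := by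
  obtain ⟨e, he⟩ := exists_eval_ne_zero_complex hg0
  obtain ⟨h, hdeg, hpair, hroot, htop⟩ := hg.exists_contraction hr1 (by omega) hmin he
  have hh0 : h ≠ 0 := by
    rintro rfl
    simpa using hpair 1 (by rw [natDegree_one]; omega)
  obtain ⟨m, hm⟩ := exists_eval_ne_zero_complex (mul_ne_zero hh0 (X_sub_C_ne_zero e))
  rw [eval_mul, mul_ne_zero_iff] at hm
  obtain ⟨n, hn⟩ : ∃ n, d + 1 - r = n := ⟨_, rfl⟩
  rw [hn] at hdeg htop ⊢
  set p : ℂ[X] := (X - C m) ^ (n - r) with hp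
  have hpm : p.Monic := (monic_X_sub_C m).pow _
  have hpdeg : p.natDegree = n - r := by
    rw [hp, (monic_X_sub_C m).natDegree_pow, natDegree_X_sub_C, mul_one]
  have hpe : p.eval e ≠ 0 := by
    rw [hp, eval_pow]
    refine pow_ne_zero _ ?_
    have := hm.2
    rw [eval_sub, eval_X, eval_C, sub_ne_zero] at this ⊢
    exact this.symm
  have hV : (p * g).natDegree ≤ n :=
    (natDegree_mul_le_of_le hpdeg.le hg.1).trans (by omega)
  obtain ⟨S, hS, hpencil⟩ := exists_finite_pencil_nodup_roots (by omega) hdeg hV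
    (by
      have := coeff_mul_add_eq_of_natDegree_le hpdeg.le hg.1
      rw [← hpdeg, hpm.coeff_natDegree, hpdeg, show n - r + r = n by omega, one_mul] at this
      rwa [this])
    (fun z hz => by
      rw [eval_mul]
      refine mul_ne_zero ?_ (hroot z hz)
      rw [hp, eval_pow]
      refine pow_ne_zero _ ?_
      rw [eval_sub, eval_X, eval_C, sub_ne_zero]
      rintro rfl
      exact hm.1 hz)
  refine ⟨e, {0} ∪ (fun t => -(h.eval e + t * (p.eval e * g.eval e))⁻¹) '' S,
    (Set.finite_singleton _).union (hS.image _), fun a ha => ?_⟩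
  rw [Set.mem_union, not_or, Set.mem_singleton_iff] at ha
  obtain ⟨ha0, haS⟩ := ha
  set t := (-a⁻¹ - h.eval e) / (p.eval e * g.eval e) with ht
  have hte : h.eval e + t * (p.eval e * g.eval e) = -a⁻¹ := by
    rw [ht, div_mul_cancel₀ _ (mul_ne_zero hpe he)]
    ring
  have htS : t ∉ S := fun h' => haS ⟨t, h', by simp only [hte, inv_neg, inv_inv, neg_neg]⟩
  obtain ⟨hN, hnodup⟩ := hpencil t htS
  refine IsApolar.exists_sum_roots (q := h + C t * (p * g))
    (hf.add ((linForm2_pow_isHomogeneous d _).C_mul a)) ⟨hN.le, fun q hq => ?_⟩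
    (by omega) hN hnodup
  have hpq : (p * q).natDegree ≤ n - r + q.natDegree := natDegree_mul_le_of_le hpdeg.le le_rfl
  have h1 : apolarPairing d f ((h + C t * (p * g)) * q) = q.eval e := by
    rw [add_mul, map_add, hpair q (by omega), mul_assoc (C t), ← smul_eq_C_mul, map_smul,
      mul_comm p g, mul_assoc, hg.2 _ (by omega), smul_zero, add_zero]
  rw [map_add, LinearMap.add_apply, h1, ← MvPolynomial.smul_eq_C_mul, map_smul,
    LinearMap.smul_apply, apolarPairing_linForm2_one_pow e
      ((natDegree_mul_le_of_le hN.le le_rfl).trans (by omega)), smul_eq_mul, eval_mul, eval_add,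
    eval_mul, eval_C, eval_mul, hte]
  field_simp
  ring

/-- If the rank of `f` exceeds the lowest degree `r` of an apolar form, it equals `d + 2 - r`. -/
lemma IsApolar.two_mul_le_and_eq (hf : f.IsHomogeneous d) (hg0 : g ≠ 0) (hg : IsApolar d f r g)
    (hr1 : 1 ≤ r) (hrd : 2 * r ≤ d + 2) (hmin : ∀ g', IsApolar d f (r - 1) g' → g' = 0)
    (hlt : r < waringRank2 d f) : 2 * r ≤ d + 1 ∧ d + 2 ≤ waringRank2 d f + r := by
  have hle : ∀ k, WaringRankLE2 d f k → waringRank2 d f ≤ k := fun k hk => Nat.sInf_le hk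
  refine ⟨?_, ?_⟩
  · by_contra! h
    have := hle _ (hg.waringRankLE2_of_eq hf hg0 hr1 (by omega) hmin)
    omega
  · by_contra! h
    have hmem : WaringRankLE2 d f (waringRank2 d f) :=
      Nat.sInf_mem (Nat.nonempty_of_pos_sInf (Nat.zero_lt_of_lt hlt))
    obtain ⟨k, hk, hfk⟩ := hg.waringRankLE2_of_le hg0 hr1 (by omega) hmem
    have := hle _ hfk
    omega

lemma IsApolar.borderWaringRank2_lt (hf : f.IsHomogeneous d) (hg0 : g ≠ 0) (hg : IsApolar d f r g)
    (hr1 : 1 ≤ r) (hrd : 2 * r ≤ d + 2) (hmin : ∀ g', IsApolar d f (r - 1) g' → g' = 0)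
    (hlt : r < waringRank2 d f) : borderWaringRank2 d f < waringRank2 d f := by
  obtain ⟨h2r, hR⟩ := hg.two_mul_le_and_eq hf hg0 hr1 hrd hmin hlt
  obtain ⟨e, S, hS, hpert⟩ := hg.exists_perturbation hf hg0 hr1 h2r hmin
  refine lt_of_le_of_lt (Nat.sInf_le (m := d + 1 - r) ?_) (by omega)
  let _ : TopologicalSpace (MvPolynomial (Fin 2) ℂ) := euclTop _
  let γ : ℂ → MvPolynomial (Fin 2) ℂ := fun a => f + MvPolynomial.C a * linForm2 ![1, e] ^ d
  have hγ : Continuous γ := by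
    refine continuous_iInf_rng.mpr fun φ => continuous_induced_rng.mpr ?_
    have : (φ ∘ γ) = fun a => φ f + a * φ (linForm2 ![1, e] ^ d) := by
      funext a
      simp [γ, ← MvPolynomial.smul_eq_C_mul]
    rw [this]
    fun_prop
  have h0 : γ 0 = f := by simp [γ]
  have hdense : (0 : ℂ) ∈ closure Sᶜ := by
    have := (dense_univ.sdiff_finite hS : Dense (Set.univ \ S)) 0
    rwa [← Set.compl_eq_univ_sdiff] at this
  rw [Set.mem_ofPred_eq, ← h0]
  refine map_mem_closure hγ hdense fun a ha => ?_
  obtain ⟨B, c, hB, hsum⟩ := hpert a ha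
  change WaringRankLE2 d (f + _) _
  rw [hsum, ← hB]
  exact waringRankLE2_sum d B c fun β => ![1, β]

lemma IsApolar.prodRank2_lt (hf : f.IsHomogeneous d) (hg0 : g ≠ 0) (hg : IsApolar d f r g)
    (hr1 : 1 ≤ r) (hrd : 2 * r ≤ d + 2) (hmin : ∀ g', IsApolar d f (r - 1) g' → g' = 0)
    (hlt : r < waringRank2 d f) : prodRank2 d d (f ⊗ₜ[ℂ] f) < waringRank2 d f ^ 2 := by
  classical
  obtain ⟨h2r, hR⟩ := hg.two_mul_le_and_eq hf hg0 hr1 hrd hmin hlt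
  obtain ⟨e, S, hS, hpert⟩ := hg.exists_perturbation hf hg0 hr1 h2r hmin
  obtain ⟨n, hn⟩ : ∃ n, d + 1 - r = n := ⟨_, rfl⟩
  rw [hn] at hpert
  -- a decomposition of `f` with nonzero coefficients, supported on `n + 1` points
  obtain ⟨B, c, hc, hB, hsum⟩ : ∃ (B : Finset ℂ) (c : ℂ → ℂ), (∀ β ∈ B, c β ≠ 0) ∧
      B.card ≤ n + 1 ∧ f = ∑ β ∈ B, MvPolynomial.C (c β) * linForm2 ![1, β] ^ d := by
    obtain ⟨a, ha⟩ := hS.infinite_compl.nonempty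
    obtain ⟨B₀, c₀, hB₀, hsum₀⟩ := hpert a ha
    let c : ℂ → ℂ := fun β => (if β ∈ B₀ then c₀ β else 0) - if β = e then a else 0
    refine ⟨(insert e B₀).filter fun β => c β ≠ 0, c, fun β hβ => (mem_filter.mp hβ).2,
      (card_filter_le _ _).trans (hB₀ ▸ card_insert_le e B₀), ?_⟩
    rw [sum_filter_of_ne (p := fun β => c β ≠ 0)
      (f := fun β => MvPolynomial.C (c β) * linForm2 ![1, β] ^ d)
      fun β _ hβ h => hβ (by simp [h])]
    refine (eq_sub_of_add_eq hsum₀).trans ?_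
    simp only [c, map_sub, sub_mul, sum_sub_distrib]
    congr 1
    · rw [← sum_subset (subset_insert e B₀)]
      · exact sum_congr rfl fun β hβ => by simp [hβ]
      · intro β _ hβ
        simp [hβ]
    · rw [sum_eq_single_of_mem e (mem_insert_self e B₀)]
      · simp
      · intro β _ hβ
        simp [hβ]
  have hBR : waringRank2 d f ≤ B.card := Nat.sInf_le (by
    change WaringRankLE2 d f _
    rw [hsum]
    exact waringRankLE2_sum d B c fun β => ![1, β])
  -- a combination of the same powers with nonzero coefficients and rank at most `r`
  obtain ⟨D, hBD, hD⟩ := Infinite.exists_superset_card_eq B (d + 2) (by omega)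
  obtain ⟨w, hw0, hw⟩ := exists_eval_relation hD
  set f' : MvPolynomial (Fin 2) ℂ := ∑ β ∈ B, MvPolynomial.C (w β) * linForm2 ![1, β] ^ d with hf'
  have hf'r : WaringRankLE2 d f' r := by
    have hrel : ∑ β ∈ D, MvPolynomial.C (w β) * linForm2 ![1, β] ^ d = 0 := by
      refine eq_of_apolarPairing (d := d) (MvPolynomial.IsHomogeneous.sum _ _ _ fun β _ =>
        (linForm2_pow_isHomogeneous d _).C_mul _) (MvPolynomial.isHomogeneous_zero _ _ d)
        fun p hp => ?_
      rw [map_zero, LinearMap.zero_apply, ← hw p hp, map_sum, LinearMap.sum_apply]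
      refine sum_congr rfl fun β _ => ?_
      rw [← MvPolynomial.smul_eq_C_mul, map_smul, LinearMap.smul_apply, smul_eq_mul,
        apolarPairing_linForm2_one_pow β hp]
    have hcard : (D \ B).card = r := by
      rw [card_sdiff_of_subset hBD]
      omega
    have : f' = ∑ β ∈ D \ B, MvPolynomial.C (-w β) * linForm2 ![1, β] ^ d := by
      rw [← sum_sdiff hBD] at hrel
      simp only [map_neg, neg_mul, sum_neg_distrib]
      exact eq_neg_of_add_eq_zero_right hrel
    rw [this, ← hcard]
    exact waringRankLE2_sum d (D \ B) (fun β => -w β) fun β => ![1, β]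
  -- a scaling for which all relevant perturbations of `f` are good
  obtain ⟨s, hs⟩ : ∃ s, ∀ β ∈ B, s * (w β / c β) ∉ S := by
    have hfin : (⋃ β ∈ B, (fun s => s * (w β / c β)) ⁻¹' S).Finite := by
      refine B.finite_toSet.biUnion fun β hβ => hS.preimage ?_
      exact (mul_left_injective₀ (div_ne_zero (hw0 β (hBD hβ)) (hc β hβ))).injOn
    obtain ⟨s, hs⟩ := hfin.infinite_compl.nonempty
    exact ⟨s, fun β hβ h => hs (Set.mem_biUnion hβ h)⟩
  have hdecomp : f ⊗ₜ[ℂ] f =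
      (∑ β ∈ B, c β • ((f + MvPolynomial.C (s * (w β / c β)) * linForm2 ![1, e] ^ d) ⊗ₜ[ℂ]
        (linForm2 ![1, β] ^ d : MvPolynomial (Fin 2) ℂ))) +
      (-s) • ((linForm2 ![1, e] ^ d : MvPolynomial (Fin 2) ℂ) ⊗ₜ[ℂ] f') := by
    have h1 : f ⊗ₜ[ℂ] f =
        ∑ β ∈ B, c β • (f ⊗ₜ[ℂ] (linForm2 ![1, β] ^ d : MvPolynomial (Fin 2) ℂ)) := by
      refine (congrArg (fun q => f ⊗ₜ[ℂ] q) hsum).trans ?_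
      simp only [TensorProduct.tmul_sum, ← MvPolynomial.smul_eq_C_mul, TensorProduct.tmul_smul]
    rw [h1, hf', TensorProduct.tmul_sum, smul_sum, ← sum_add_distrib]
    refine sum_congr rfl fun β hβ => ?_
    rw [← MvPolynomial.smul_eq_C_mul, ← MvPolynomial.smul_eq_C_mul, TensorProduct.add_tmul,
      TensorProduct.tmul_smul, ← TensorProduct.smul_tmul', smul_add, smul_smul, smul_smul,
      show c β * (s * (w β / c β)) = s * w β by field_simp [hc β hβ]]
    module
  have hprod : ProdRankLE2 d d (f ⊗ₜ[ℂ] f) (B.card * n + r) := by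
    rw [hdecomp]
    refine (ProdRankLE2.sum B fun β hβ => ProdRankLE2.smul ?_ _).add
      ((hf'r.linForm2_pow_tmul _).smul _)
    obtain ⟨B', c', hB', hsum'⟩ := hpert _ (hs β hβ)
    rw [hsum', ← hB']
    exact (waringRankLE2_sum d B' c' fun β => ![1, β]).tmul_linForm2_pow _
  have hle : prodRank2 d d (f ⊗ₜ[ℂ] f) ≤ B.card * n + r := Nat.sInf_le hprod
  have hRn : waringRank2 d f = n + 1 := by omega
  have hBn : B.card = n + 1 := by omega
  rw [hBn] at hle
  rw [hRn] at hlt ⊢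
  nlinarith

end Comparison

theorem stmt12 (d : ℕ) (f : MvPolynomial (Fin 2) ℂ) (hf : f ≠ 0)
    (hhom : f.IsHomogeneous d) :
    borderWaringRank2 d f < waringRank2 d f ↔
      prodRank2 d d (f ⊗ₜ[ℂ] f) < (waringRank2 d f) ^ 2 := by
  obtain ⟨r, g, hg0, hg, hr1, hrd, hmin⟩ := exists_isApolar_minimal hf hhom
  refine ⟨fun h => ?_, fun h => ?_⟩
  · refine hg.prodRank2_lt hhom hg0 hr1 hrd hmin (lt_of_le_of_lt ?_ h)
    have hR : WaringRankLE2 d f (waringRank2 d f) :=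
      Nat.sInf_mem (Nat.nonempty_of_pos_sInf (Nat.zero_lt_of_lt h))
    exact le_csInf ⟨_, @subset_closure _ (euclTop _) _ _ hR⟩ fun ρ hρ =>
      le_of_mem_closure_waringRankLE2 hr1 (by omega) hmin hρ
  · refine hg.borderWaringRank2_lt hhom hg0 hr1 hrd hmin ?_
    have hpos : 0 < waringRank2 d f := Nat.pos_of_ne_zero fun h0 => by simp [h0] at h
    have hR : WaringRankLE2 d f (waringRank2 d f) :=
      Nat.sInf_mem (Nat.nonempty_of_pos_sInf hpos)
    refine lt_of_pow_lt_pow_left₀ 2 (Nat.zero_le _) (lt_of_le_of_lt ?_ h)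
    exact le_csInf ⟨_, hR.tmul hR⟩ fun N ⟨c, l1, l2, hN⟩ =>
      sq_le_of_tmul_self_eq_sum hr1 (by omega) hmin c l1 l2 hN
end
end
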